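/- arXiv:2007.03760 — 2 statements merged into one kernel-verified Lean document; each statement's English description precedes it below -/
import Mathlib

section
/- For every 0 < d_m <= 1/(SA), define the problem class M_{d_m} := { (mu, M) : min_{t, s, a} d_t^mu(s,a) >= d_m }, where M ranges over time-inhomogeneous H-horizon MDPs with S states, A actions and rewards in [0,1], and mu is a logging policy for M. There exist universal constants c1, c2, c3 and p > 0 such that whenever H, S, A >= c1 and 0 < eps < c2: if n <= c3 H^3 / (d_m eps^2), then for every off-policy-evaluation procedure vhat (any measurable map from n episodes generated by mu to a value estimate vhat^pi for each policy pi), sup_{(mu,M) in M_{d_m}} P_{mu,M}( sup_{pi in Pi} |vhat^pi - v^pi| >= eps ) >= p, where Pi is the class of all non-stationary deterministic policies. -/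
open MeasureTheory Finset

noncomputable section

namespace OPE

/-- A finite, time-inhomogeneous episodic MDP (time indexed by `ℕ`; only times `< H` are used).
`P t s a s'` is the probability of transitioning from `(s, a)` at time `t` to state `s'` at
time `t+1`, `r t s a` is the mean reward, and `d₁` the initial state distribution. -/
structure MDP (S A : Type) [Fintype S] [Fintype A] where
  P : ℕ → S → A → S → ℝ
  P_nonneg : ∀ t s a s', 0 ≤ P t s a s'
  P_sum : ∀ t s a, ∑ s', P t s a s' = 1
  r : ℕ → S → A → ℝ
  r_nonneg : ∀ t s a, 0 ≤ r t s a
  r_le_one : ∀ t s a, r t s a ≤ 1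
  d₁ : S → ℝ
  d₁_nonneg : ∀ s, 0 ≤ d₁ s
  d₁_sum : ∑ s, d₁ s = 1

variable {S A : Type} [Fintype S] [Fintype A] [DecidableEq S] [DecidableEq A]
  [Inhabited S] [Inhabited A]

/-- A (possibly stochastic, non-stationary) policy. -/
def IsPolicy (π : ℕ → S → A → ℝ) : Prop :=
  (∀ t s a, 0 ≤ π t s a) ∧ ∀ t s, ∑ a, π t s a = 1

/-- The stochastic policy associated with a deterministic policy. -/
def detToPolicy (g : ℕ → S → A) : ℕ → S → A → ℝ := fun t s a => if a = g t s then 1 else 0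

/-- Marginal state-action distribution at time `t` under transitions `P`, initial state
distribution `d₁` and policy `π`. -/
def margDist (P : ℕ → S → A → S → ℝ) (d₁ : S → ℝ) (π : ℕ → S → A → ℝ) : ℕ → S × A → ℝ
  | 0 => fun q => d₁ q.1 * π 0 q.1 q.2
  | t + 1 => fun q => π (t + 1) q.1 q.2 * ∑ p : S × A, P t p.1 p.2 q.1 * margDist P d₁ π t p

/-- Value iteration with `k` steps to go, starting at time `t`. -/
def Vaux (P : ℕ → S → A → S → ℝ) (r : ℕ → S → A → ℝ) (π : ℕ → S → A → ℝ) : ℕ → ℕ → S → ℝ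
  | 0, _, _ => 0
  | k + 1, t, s => ∑ a, π t s a * (r t s a + ∑ s', P t s a s' * Vaux P r π k (t + 1) s')

/-- Value function `V_t^π` of policy `π` in the `H`-horizon MDP with transitions `P`,
mean rewards `r`. -/
def Vf (P : ℕ → S → A → S → ℝ) (r : ℕ → S → A → ℝ) (π : ℕ → S → A → ℝ) (H t : ℕ) :
    S → ℝ := Vaux P r π (H - t) t

/-- Q-function `Q_t^π`. -/
def Qf (P : ℕ → S → A → S → ℝ) (r : ℕ → S → A → ℝ) (π : ℕ → S → A → ℝ) (H t : ℕ) :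
    S → A → ℝ := fun s a => r t s a + ∑ s', P t s a s' * Vf P r π H (t + 1) s'

/-- The value `v^π = E_π[∑_{t<H} r_t]` of policy `π`. -/
def polValue (P : ℕ → S → A → S → ℝ) (r : ℕ → S → A → ℝ) (d₁ : S → ℝ)
    (π : ℕ → S → A → ℝ) (H : ℕ) : ℝ :=
  ∑ t ∈ Finset.range H, ∑ q : S × A, margDist P d₁ π t q * r t q.1 q.2

/-- Optimal value iteration. -/
def VstarAux (M : MDP S A) : ℕ → ℕ → S → ℝ
  | 0, _, _ => 0
  | k + 1, t, s => ⨆ a : A, (M.r t s a + ∑ s', M.P t s a s' * VstarAux M k (t + 1) s')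

/-- The optimal value `v* = max_π v^π`. -/
def vStar (M : MDP S A) (H : ℕ) : ℝ := ∑ s, M.d₁ s * VstarAux M H 0 s

/-- An episode: the state-action pairs and (random, real-valued) rewards at times `0, …, H-1`. -/
abbrev Episode (S A : Type) (H : ℕ) : Type := (Fin H → S × A) × (Fin H → ℝ)

/-- A dataset of `n` episodes. -/
abbrev Dataset (S A : Type) (H n : ℕ) : Type := Fin n → Episode S A H

/-- Safe access to the `t`-th entry of a path. -/
def pget {H : ℕ} (p : Fin H → S × A) (t : ℕ) : S × A := if h : t < H then p ⟨t, h⟩ else default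

/-- State-action pair of episode `e` at time `t`. -/
def esa {H : ℕ} (e : Episode S A H) (t : ℕ) : S × A := pget e.1 t

/-- Reward of episode `e` at time `t`. -/
def erew {H : ℕ} (e : Episode S A H) (t : ℕ) : ℝ := if h : t < H then e.2 ⟨t, h⟩ else 0

/-- Visitation count `n_{s,a}` at time `t`. -/
def cnt {H n : ℕ} (D : Dataset S A H n) (t : ℕ) (q : S × A) : ℕ :=
  (univ.filter fun i => esa (D i) t = q).card

/-- Count of transitions from `q` at time `t` to state `s'` at time `t+1`. -/
def cnt2 {H n : ℕ} (D : Dataset S A H n) (t : ℕ) (s' : S) (q : S × A) : ℕ :=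
  (univ.filter fun i => esa (D i) t = q ∧ (esa (D i) (t + 1)).1 = s').card

/-- Empirical transition kernel `P̂`. -/
def Phat {H n : ℕ} (D : Dataset S A H n) : ℕ → S → A → S → ℝ := fun t s a s' =>
  if cnt D t (s, a) = 0 then 0 else (cnt2 D t s' (s, a) : ℝ) / (cnt D t (s, a) : ℝ)

/-- Empirical mean reward `r̂`. -/
def rhat {H n : ℕ} (D : Dataset S A H n) : ℕ → S → A → ℝ := fun t s a =>
  if cnt D t (s, a) = 0 then 0
  else (∑ i, if esa (D i) t = (s, a) then erew (D i) t else 0) / (cnt D t (s, a) : ℝ)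

/-- Empirical initial state distribution. -/
def d1hat {H n : ℕ} (D : Dataset S A H n) : S → ℝ := fun s =>
  ((univ.filter fun i => (esa (D i) 0).1 = s).card : ℝ) / (n : ℝ)

/-- The OPEMA (model-based plug-in) estimator of `v^π`, built from the full dataset `D`. -/
def vhat {H n : ℕ} (D : Dataset S A H n) (π : ℕ → S → A → ℝ) : ℝ :=
  polValue (Phat D) (rhat D) (d1hat D) π H

/-- `N`: the minimum visitation count over all times `t < H` and all state-action pairs that are
accessible under the logging policy `μ`. -/
def Nmin {H n : ℕ} (M : MDP S A) (μ : ℕ → S → A → ℝ) (D : Dataset S A H n) : ℕ :=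
  sInf {k | ∃ t < H, ∃ q : S × A, 0 < margDist M.P M.d₁ μ t q ∧ cnt D t q = k}

/-- Number of episodes before `i` visiting `q` at time `t` (used to select the first `N`
transitions at each state-action pair). -/
def rankLt {H n : ℕ} (D : Dataset S A H n) (t : ℕ) (q : S × A) (i : Fin n) : ℕ :=
  (univ.filter fun j => j < i ∧ esa (D j) t = q).card

/-- Transition counts using only the first `N` visits to each state-action pair
(the sub-dataset `D'`). -/
def cnt2' {H n : ℕ} (D : Dataset S A H n) (N t : ℕ) (s' : S) (q : S × A) : ℕ :=
  (univ.filter fun i => esa (D i) t = q ∧ (esa (D i) (t + 1)).1 = s' ∧ rankLt D t q i < N).card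

/-- Empirical transition kernel built from the sub-dataset `D'`. -/
def Phat' {H n : ℕ} (D : Dataset S A H n) (N : ℕ) : ℕ → S → A → S → ℝ := fun t s a s' =>
  if N = 0 then 0 else (cnt2' D N t s' (s, a) : ℝ) / (N : ℝ)

/-- Empirical mean reward built from the sub-dataset `D'`. -/
def rhat' {H n : ℕ} (D : Dataset S A H n) (N : ℕ) : ℕ → S → A → ℝ := fun t s a =>
  if N = 0 then 0
  else (∑ i, if esa (D i) t = (s, a) ∧ rankLt D t (s, a) i < N then erew (D i) t else 0) / (N : ℝ)

/-- The OPEMA estimator built from the sub-dataset `D'`. -/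
def vhat' {H n : ℕ} (M : MDP S A) (μ : ℕ → S → A → ℝ) (D : Dataset S A H n)
    (π : ℕ → S → A → ℝ) : ℝ :=
  polValue (Phat' D (Nmin M μ D)) (rhat' D (Nmin M μ D)) (d1hat D) π H

/-- Fictitious transition kernel `P̃` (full dataset): equals `P̂` on the event
`E_t(s,a) = {n_{s,a} ≥ n d_t^μ(s,a)/2}` and the true `P` otherwise. -/
def Ptil {H n : ℕ} (M : MDP S A) (μ : ℕ → S → A → ℝ) (D : Dataset S A H n) :
    ℕ → S → A → S → ℝ := fun t s a s' =>
  if (n : ℝ) * margDist M.P M.d₁ μ t (s, a) / 2 ≤ (cnt D t (s, a) : ℝ) then Phat D t s a s'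
  else M.P t s a s'

/-- Fictitious mean reward `r̃` (full dataset). -/
def rtil {H n : ℕ} (M : MDP S A) (μ : ℕ → S → A → ℝ) (D : Dataset S A H n) :
    ℕ → S → A → ℝ := fun t s a =>
  if (n : ℝ) * margDist M.P M.d₁ μ t (s, a) / 2 ≤ (cnt D t (s, a) : ℝ) then rhat D t s a
  else M.r t s a

/-- Fictitious marginal state-action distribution `d̃_t^π` (full dataset). -/
def dtil {H n : ℕ} (M : MDP S A) (μ : ℕ → S → A → ℝ) (D : Dataset S A H n)
    (π : ℕ → S → A → ℝ) : ℕ → S × A → ℝ :=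
  margDist (Ptil M μ D) (d1hat D) π

/-- Fictitious transition kernel built from the sub-dataset `D'`: equals the `D'`-based
empirical kernel on the event `E = {N ≥ n d_m/2}` and the true `P` otherwise. -/
def Ptil' {H n : ℕ} (M : MDP S A) (μ : ℕ → S → A → ℝ) (dm : ℝ) (D : Dataset S A H n) :
    ℕ → S → A → S → ℝ := fun t s a s' =>
  if (n : ℝ) * dm / 2 ≤ (Nmin M μ D : ℝ) then Phat' D (Nmin M μ D) t s a s' else M.P t s a s'

/-- Fictitious marginal state-action distribution built from the sub-dataset `D'`. -/
def dtil' {H n : ℕ} (M : MDP S A) (μ : ℕ → S → A → ℝ) (dm : ℝ) (D : Dataset S A H n)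
    (π : ℕ → S → A → ℝ) : ℕ → S × A → ℝ :=
  margDist (Ptil' M μ dm D) (d1hat D) π

/-- `dm` is a positive lower bound for all positive marginal state-action occupancies of the
logging policy `μ` (i.e. `dm ≤ d_m := min{d_t^μ(s,a) : d_t^μ(s,a) > 0}`). -/
def DmLB (M : MDP S A) (μ : ℕ → S → A → ℝ) (H : ℕ) (dm : ℝ) : Prop :=
  0 < dm ∧ ∀ t < H, ∀ q : S × A, 0 < margDist M.P M.d₁ μ t q → dm ≤ margDist M.P M.d₁ μ t q

/-- Assumption 2 (exploration requirement): the logging policy `μ` visits every accessible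
state with positive probability. -/
def Explores (M : MDP S A) (μ : ℕ → S → A → ℝ) (H : ℕ) : Prop :=
  ∀ t < H, ∀ s : S,
    (∃ π, IsPolicy π ∧ 0 < ∑ a, margDist M.P M.d₁ π t (s, a)) →
    0 < ∑ a, margDist M.P M.d₁ μ t (s, a)

section Law

variable [MeasurableSpace S] [MeasurableSpace A]

/-- Probability of a state-action path under the logging policy `μ`. -/
def pathWeight (M : MDP S A) (μ : ℕ → S → A → ℝ) {H : ℕ} (p : Fin H → S × A) : ℝ :=
  (M.d₁ (pget p 0).1 * μ 0 (pget p 0).1 (pget p 0).2) *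
    ∏ t ∈ Finset.range (H - 1),
      (M.P t (pget p t).1 (pget p t).2 (pget p (t + 1)).1 *
        μ (t + 1) (pget p (t + 1)).1 (pget p (t + 1)).2)

/-- The law of a single episode generated by the logging policy `μ` in the MDP `M`, with reward
distributions `R t s a` (supported on `[0,1]` with mean `M.r t s a`). -/
def episodeLaw (M : MDP S A) (μ : ℕ → S → A → ℝ) (R : ℕ → S → A → Measure ℝ) (H : ℕ) :
    Measure (Episode S A H) :=
  ∑ p : Fin H → S × A,
    ENNReal.ofReal (pathWeight M μ p) •
      ((Measure.dirac p).prod (Measure.pi fun t : Fin H => R (t : ℕ) (p t).1 (p t).2))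

/-- The law of a dataset of `n` i.i.d. episodes generated by `μ` in `M`. -/
def datasetLaw (M : MDP S A) (μ : ℕ → S → A → ℝ) (R : ℕ → S → A → Measure ℝ) (H n : ℕ) :
    Measure (Dataset S A H n) :=
  Measure.pi fun _ : Fin n => episodeLaw M μ R H

/-- The reward distributions `R` are probability measures supported on `[0,1]` whose means are
the mean rewards of `M`. -/
def ValidReward (M : MDP S A) (R : ℕ → S → A → Measure ℝ) : Prop :=
  ∀ t s a, IsProbabilityMeasure (R t s a) ∧ (R t s a) (Set.Icc (0 : ℝ) 1)ᶜ = 0 ∧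
    (∫ x, x ∂(R t s a)) = M.r t s a

end Law

end OPE

namespace OPE

section FiniteAssouad

/-- Le Cam's inequality between the overlap and the Bhattacharyya affinity of two discrete
distributions. -/
lemma affinity_sq_le_two_mul_overlap {X : Type*} [Fintype X] {P Q : X → ℝ}
    (hP : ∀ x, 0 ≤ P x) (hQ : ∀ x, 0 ≤ Q x) (hP1 : ∑ x, P x = 1) (hQ1 : ∑ x, Q x = 1) :
    (∑ x, √(P x * Q x)) ^ 2 ≤ 2 * ∑ x, min (P x) (Q x) := by
  have hmin : ∀ x, 0 ≤ min (P x) (Q x) := fun x => le_min (hP x) (hQ x)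
  have hmax : ∀ x, 0 ≤ max (P x) (Q x) := fun x => le_max_of_le_left (hP x)
  have h := Finset.sum_mul_sq_le_sq_mul_sq univ
    (fun x => √(min (P x) (Q x))) (fun x => √(max (P x) (Q x)))
  simp only [Real.sq_sqrt (hmin _), Real.sq_sqrt (hmax _), ← Real.sqrt_mul (hmin _),
    min_mul_max] at h
  have hle : ∑ x, max (P x) (Q x) ≤ 2 := by
    calc ∑ x, max (P x) (Q x) ≤ ∑ x, (P x + Q x) :=
          Finset.sum_le_sum fun x _ => max_le_add_of_nonneg (hP x) (hQ x)
      _ = 2 := by rw [Finset.sum_add_distrib, hP1, hQ1]; norm_num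
  nlinarith [Finset.sum_nonneg fun x (_ : x ∈ univ) => hmin x]

/-- Assouad's lemma for discrete distributions indexed by a hypercube, in the form of a bound on
the probability that a datum is compatible only with hypotheses at small weighted Hamming
distance from each other. -/
lemma exists_failure_ge {ι X : Type*} [Fintype ι] [DecidableEq ι] [Fintype X]
    (c : ι → ℝ) (hc : ∀ i, 0 ≤ c i) (W : (ι → Bool) → X → ℝ) (hW : ∀ θ x, 0 ≤ W θ x)
    (hW1 : ∀ θ, ∑ x, W θ x = 1) {β B : ℝ}
    (hmin : ∀ θ i, β ≤ ∑ x, min (W θ x) (W (Function.update θ i (!θ i)) x))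
    (good : (ι → Bool) → X → Prop) [∀ θ, DecidablePred (good θ)]
    (hgood : ∀ x θ θ', good θ x → good θ' x → ∑ i, (if θ i ≠ θ' i then c i else 0) ≤ B)
    (hC : 0 < ∑ i, c i) (hB : B ≤ β / 4 * ∑ i, c i) :
    ∃ θ, β / 4 ≤ ∑ x with ¬ good θ x, W θ x := by
  by_contra! hcon
  have hsel : ∀ x, ∃ θ₀ : ι → Bool, ∀ θ, good θ x → good θ₀ x := by
    intro x
    by_cases h : ∃ θ, good θ x
    · obtain ⟨θ₀, h₀⟩ := h
      exact ⟨θ₀, fun _ _ => h₀⟩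
    · exact ⟨fun _ => true, fun θ hθ => (h ⟨θ, hθ⟩).elim⟩
  choose est hest using hsel
  set C := ∑ i, c i with hCdef
  have hupper : ∀ θ, ∑ x, W θ x * ∑ i, (if est x i ≠ θ i then c i else 0) < β / 2 * C := by
    intro θ
    calc ∑ x, W θ x * ∑ i, (if est x i ≠ θ i then c i else 0)
        ≤ ∑ x, (W θ x * B + if ¬ good θ x then W θ x * (C - B) else 0) := by
          refine Finset.sum_le_sum fun x _ => ?_
          by_cases h : good θ x
          · simpa [h] using mul_le_mul_of_nonneg_left (hgood x _ _ (hest x θ h) h) (hW θ x)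
          · have : ∑ i, (if est x i ≠ θ i then c i else 0) ≤ C :=
              Finset.sum_le_sum fun i _ => by split_ifs <;> simp [hc i]
            simp only [h, not_false_eq_true, if_true]
            nlinarith [mul_le_mul_of_nonneg_left this (hW θ x)]
      _ = B + (∑ x with ¬ good θ x, W θ x) * (C - B) := by
          rw [Finset.sum_add_distrib, ← Finset.sum_mul, hW1, one_mul, ← Finset.sum_filter,
            Finset.sum_mul]
      _ < β / 2 * C := by
          have h1 := hcon θ
          have h0 : 0 ≤ ∑ x with ¬ good θ x, W θ x := Finset.sum_nonneg fun x _ => hW θ x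
          have hle : ∑ x with ¬ good θ x, W θ x ≤ 1 := by
            rw [← hW1 θ]
            exact Finset.sum_le_sum_of_subset_of_nonneg (Finset.filter_subset _ _)
              fun x _ _ => hW θ x
          have h2 : 0 ≤ β * C := mul_nonneg (by linarith) hC.le
          nlinarith [mul_le_mul_of_nonneg_right hB (sub_nonneg.2 hle),
            mul_lt_mul_of_pos_right h1 hC, mul_nonneg h2 h0]
  have hflip : ∀ i, Function.Involutive (fun θ : ι → Bool => Function.update θ i (!θ i)) := by
    intro i θ
    simp
  have hcoord : ∀ i, (Fintype.card (ι → Bool) : ℝ) * β ≤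
      2 * ∑ θ, ∑ x, (if est x i ≠ θ i then W θ x else 0) := by
    intro i
    calc (Fintype.card (ι → Bool) : ℝ) * β = ∑ _θ : ι → Bool, β := by simp
      _ ≤ ∑ θ : ι → Bool, ((∑ x, (if est x i ≠ θ i then W θ x else 0)) +
            ∑ x, (if est x i ≠ (Function.update θ i (!θ i)) i
              then W (Function.update θ i (!θ i)) x else 0)) := by
          refine Finset.sum_le_sum fun θ _ => (hmin θ i).trans ?_
          rw [← Finset.sum_add_distrib]
          refine Finset.sum_le_sum fun x _ => ?_
          by_cases h : est x i = θ i
          · simp [h]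
          · simp [h]
      _ = 2 * ∑ θ, ∑ x, (if est x i ≠ θ i then W θ x else 0) := by
          rw [Finset.sum_add_distrib, two_mul]
          congr 1
          exact Equiv.sum_comp (hflip i).toPerm
            (fun θ => ∑ x, (if est x i ≠ θ i then W θ x else 0))
  have hlower : (Fintype.card (ι → Bool) : ℝ) * β * C ≤
      2 * ∑ θ, ∑ x, W θ x * ∑ i, (if est x i ≠ θ i then c i else 0) := by
    calc (Fintype.card (ι → Bool) : ℝ) * β * C
        = ∑ i, c i * ((Fintype.card (ι → Bool) : ℝ) * β) := by
          rw [hCdef, Finset.mul_sum]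
          exact Finset.sum_congr rfl fun i _ => mul_comm _ _
      _ ≤ ∑ i, c i * (2 * ∑ θ, ∑ x, (if est x i ≠ θ i then W θ x else 0)) :=
          Finset.sum_le_sum fun i _ => mul_le_mul_of_nonneg_left (hcoord i) (hc i)
      _ = 2 * ∑ θ, ∑ x, W θ x * ∑ i, (if est x i ≠ θ i then c i else 0) := by
          simp_rw [Finset.mul_sum]
          rw [Finset.sum_comm]
          refine Finset.sum_congr rfl fun θ _ => ?_
          rw [Finset.sum_comm]
          refine Finset.sum_congr rfl fun x _ => Finset.sum_congr rfl fun i _ => ?_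
          split_ifs <;> ring
  have hsum : ∑ θ, ∑ x, W θ x * ∑ i, (if est x i ≠ θ i then c i else 0) <
      ∑ _θ : ι → Bool, β / 2 * C :=
    Finset.sum_lt_sum_of_nonempty Finset.univ_nonempty fun θ _ => hupper θ
  rw [Finset.sum_const, Finset.card_univ, nsmul_eq_mul] at hsum
  nlinarith

end FiniteAssouad

section Chains

variable {X : Type} [Fintype X]

/-- Forward (unnormalised) distribution at time `t` of the chain with initial weights `ν` and
transition weights `Q`. -/
def forwardMass (ν : X → ℝ) (Q : ℕ → X → X → ℝ) : ℕ → X → ℝ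
  | 0 => ν
  | t + 1 => fun y => ∑ x, Q t x y * forwardMass ν Q t x

lemma forwardMass_nonneg {ν : X → ℝ} {Q : ℕ → X → X → ℝ} (hν : ∀ x, 0 ≤ ν x)
    (hQ : ∀ t x y, 0 ≤ Q t x y) : ∀ t x, 0 ≤ forwardMass ν Q t x
  | 0, x => hν x
  | t + 1, _ => Finset.sum_nonneg fun x _ => mul_nonneg (hQ t x _) (forwardMass_nonneg hν hQ t x)

lemma forwardMass_congr {ν : X → ℝ} {Q Q' : ℕ → X → X → ℝ} {j : ℕ}
    (h : ∀ t < j, Q t = Q' t) : forwardMass ν Q j = forwardMass ν Q' j := by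
  induction j with
  | zero => rfl
  | succ j ih =>
    funext y
    simp only [forwardMass, ih fun t ht => h t (ht.trans j.lt_succ_self), h j j.lt_succ_self]

lemma sum_forwardMass_succ (ν : X → ℝ) (Q : ℕ → X → X → ℝ) (t : ℕ) :
    ∑ y, forwardMass ν Q (t + 1) y = ∑ x, (∑ y, Q t x y) * forwardMass ν Q t x := by
  simp only [forwardMass]
  rw [Finset.sum_comm]
  exact Finset.sum_congr rfl fun x _ => (Finset.sum_mul _ _ _).symm

lemma sum_forwardMass_eq_one {ν : X → ℝ} {Q : ℕ → X → X → ℝ} (hν : ∑ x, ν x = 1)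
    (hQ : ∀ t x, ∑ y, Q t x y = 1) (t : ℕ) : ∑ x, forwardMass ν Q t x = 1 := by
  induction t with
  | zero => exact hν
  | succ t ih => rw [sum_forwardMass_succ]; simp [hQ, ih]

/-- If one step of a stochastic chain is replaced by a kernel with row sums `1 - h`, the total
mass drops at most by the expectation of `h` at that step. -/
lemma one_sub_le_sum_forwardMass {ν : X → ℝ} {Q L : ℕ → X → X → ℝ} {j : ℕ} {h : X → ℝ}
    (hν0 : ∀ x, 0 ≤ ν x) (hν : ∑ x, ν x = 1) (hQ0 : ∀ t x y, 0 ≤ Q t x y)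
    (hQ : ∀ t x, ∑ y, Q t x y = 1) (hL : ∀ t ≠ j, L t = Q t)
    (hLj : ∀ x, ∑ y, L j x y = 1 - h x) (hh : ∀ x, 0 ≤ h x) (t : ℕ) :
    1 - ∑ x, h x * forwardMass ν Q j x ≤ ∑ x, forwardMass ν L t x := by
  have hle : ∀ t ≤ j, forwardMass ν L t = forwardMass ν Q t := fun t ht =>
    forwardMass_congr fun s hs => hL s (by omega)
  rcases le_or_gt t j with ht | ht
  · rw [hle t ht, sum_forwardMass_eq_one hν hQ]
    have := Finset.sum_nonneg fun x (_ : x ∈ univ) =>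
      mul_nonneg (hh x) (forwardMass_nonneg hν0 hQ0 j x)
    linarith
  · induction t, ht using Nat.le_induction with
    | base =>
      rw [Nat.succ_eq_add_one, sum_forwardMass_succ, hle j le_rfl]
      simp only [hLj, sub_mul, one_mul, Finset.sum_sub_distrib, sum_forwardMass_eq_one hν hQ]
      exact le_rfl
    | succ t ht ih =>
      rw [sum_forwardMass_succ, hL t (by omega)]
      simpa [hQ] using ih

end Chains

section Paths

variable {S A : Type} [Inhabited S] [Inhabited A]

lemma pget_snoc_of_lt {m : ℕ} (p : Fin m → S × A) (x : S × A) {t : ℕ} (ht : t < m) :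
    pget (H := m + 1) (Fin.snoc p x) t = pget p t := by
  have h' : t < m + 1 := by omega
  simp only [pget, ht, h', dif_pos]
  exact Fin.snoc_castSucc (α := fun _ => S × A) x p ⟨t, ht⟩

lemma pget_snoc_last {m : ℕ} (p : Fin m → S × A) (x : S × A) :
    pget (H := m + 1) (Fin.snoc p x) m = x := by
  simp only [pget, m.lt_succ_self, dif_pos]
  exact Fin.snoc_last (α := fun _ => S × A) x p

/-- Weight of a path of the chain with initial weights `ν` and transition weights `Q`. -/
def chainWeight (ν : S × A → ℝ) (Q : ℕ → S × A → S × A → ℝ) {H : ℕ} (p : Fin H → S × A) : ℝ :=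
  ν (pget p 0) * ∏ t ∈ Finset.range (H - 1), Q t (pget p t) (pget p (t + 1))

lemma sum_chainWeight_mul [Fintype S] [Fintype A] (ν : S × A → ℝ)
    (Q : ℕ → S × A → S × A → ℝ) (m : ℕ) (φ : S × A → ℝ) :
    ∑ p : Fin (m + 1) → S × A, chainWeight ν Q p * φ (pget p m) =
      ∑ y, forwardMass ν Q m y * φ y := by
  induction m generalizing φ with
  | zero =>
    rw [← (Equiv.funUnique (Fin 1) (S × A)).symm.sum_comp]
    simp [chainWeight, pget, forwardMass]
  | succ m ih =>
    rw [← (Fin.snocEquiv fun _ : Fin (m + 2) => S × A).sum_comp, Fintype.sum_prod_type]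
    have hstep : ∀ (x : S × A) (p : Fin (m + 1) → S × A),
        chainWeight ν Q (H := m + 2) (Fin.snoc p x) = chainWeight ν Q p * Q m (pget p m) x := by
      intro x p
      simp only [chainWeight, Nat.add_sub_cancel, show m + 2 - 1 = m + 1 from rfl]
      rw [Finset.prod_range_succ, pget_snoc_of_lt p x (by omega), pget_snoc_of_lt p x (by omega),
        pget_snoc_last, ← mul_assoc]
      congr 2
      refine Finset.prod_congr rfl fun t ht => ?_
      rw [Finset.mem_range] at ht
      rw [pget_snoc_of_lt p x (by omega), pget_snoc_of_lt p x (by omega)]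
    simp only [Fin.snocEquiv, Equiv.coe_fn_mk]
    refine Finset.sum_congr rfl fun x _ => ?_
    have := ih fun y => Q m y x
    calc ∑ p : Fin (m + 1) → S × A, chainWeight ν Q (H := m + 2) (Fin.snoc p x) *
          φ (pget (H := m + 2) (Fin.snoc p x) (m + 1))
        = (∑ p : Fin (m + 1) → S × A, chainWeight ν Q p * Q m (pget p m) x) * φ x := by
          rw [Finset.sum_mul]
          exact Finset.sum_congr rfl fun p _ => by rw [hstep, pget_snoc_last]
      _ = forwardMass ν Q (m + 1) x * φ x := by
          rw [this]
          simp only [forwardMass]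
          congr 1
          exact Finset.sum_congr rfl fun y _ => mul_comm _ _

lemma sum_chainWeight [Fintype S] [Fintype A] (ν : S × A → ℝ)
    (Q : ℕ → S × A → S × A → ℝ) {H : ℕ} (hH : 0 < H) :
    ∑ p : Fin H → S × A, chainWeight ν Q p = ∑ y, forwardMass ν Q (H - 1) y := by
  obtain ⟨m, rfl⟩ := Nat.exists_eq_succ_of_ne_zero hH.ne'
  simpa using sum_chainWeight_mul ν Q m 1

lemma chainWeight_nonneg {ν : S × A → ℝ} {Q : ℕ → S × A → S × A → ℝ} (hν : ∀ x, 0 ≤ ν x)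
    (hQ : ∀ t x y, 0 ≤ Q t x y) {H : ℕ} (p : Fin H → S × A) : 0 ≤ chainWeight ν Q p :=
  mul_nonneg (hν _) (Finset.prod_nonneg fun _ _ => hQ _ _ _)

lemma chainWeight_le_sqrt {ν : S × A → ℝ} {L Q Q' : ℕ → S × A → S × A → ℝ}
    (hL : ∀ t x y, L t x y ^ 2 ≤ Q t x y * Q' t x y) {H : ℕ} (p : Fin H → S × A) :
    chainWeight ν L p ≤ √(chainWeight ν Q p * chainWeight ν Q' p) := by
  refine Real.le_sqrt_of_sq_le ?_
  have hprod := Finset.prod_le_prod (s := Finset.range (H - 1))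
    (f := fun t => L t (pget p t) (pget p (t + 1)) ^ 2) (fun _ _ => sq_nonneg _)
    fun t _ => hL t (pget p t) (pget p (t + 1))
  rw [Finset.prod_pow, Finset.prod_mul_distrib] at hprod
  simp only [chainWeight]
  nlinarith [mul_le_mul_of_nonneg_left hprod (sq_nonneg (ν (pget p 0)))]

lemma sum_prod_chainWeight_eq_one [Fintype S] [Fintype A] {ν : S × A → ℝ}
    {Q : ℕ → S × A → S × A → ℝ} (hν : ∑ x, ν x = 1) (hQ : ∀ t x, ∑ y, Q t x y = 1) {H n : ℕ}
    (hH : 0 < H) : ∑ x : Fin n → Fin H → S × A, ∏ i, chainWeight ν Q (x i) = 1 := by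
  rw [← Fintype.sum_pow, sum_chainWeight ν Q hH, sum_forwardMass_eq_one hν hQ, one_pow]

/-- The overlap of two `n`-fold products of path distributions, bounded through a common lower
bound `L` on the geometric means of the transition kernels. -/
lemma le_two_mul_sum_min_prod_chainWeight [Fintype S] [Fintype A] {ν : S × A → ℝ}
    {L Q Q' : ℕ → S × A → S × A → ℝ} (hν0 : ∀ x, 0 ≤ ν x) (hν : ∑ x, ν x = 1)
    (hQ0 : ∀ t x y, 0 ≤ Q t x y) (hQ : ∀ t x, ∑ y, Q t x y = 1)
    (hQ0' : ∀ t x y, 0 ≤ Q' t x y) (hQ' : ∀ t x, ∑ y, Q' t x y = 1)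
    (hL : ∀ t x y, L t x y ^ 2 ≤ Q t x y * Q' t x y) {H n : ℕ} (hH : 0 < H) {δ : ℝ}
    (hδ : δ ≤ 1) (hδL : 1 - δ ≤ ∑ y, forwardMass ν L (H - 1) y) (hδn : n * δ ≤ 1) :
    (1 - n * δ) ^ 2 ≤ 2 * ∑ x : Fin n → Fin H → S × A,
      min (∏ i, chainWeight ν Q (x i)) (∏ i, chainWeight ν Q' (x i)) := by
  have h0 := chainWeight_nonneg (H := H) hν0 hQ0
  have h0' := chainWeight_nonneg (H := H) hν0 hQ0'
  refine le_trans ?_ (affinity_sq_le_two_mul_overlap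
    (fun x : Fin n → Fin H → S × A => Finset.prod_nonneg fun i _ => h0 (x i))
    (fun x => Finset.prod_nonneg fun i _ => h0' (x i))
    (sum_prod_chainWeight_eq_one hν hQ hH) (sum_prod_chainWeight_eq_one hν hQ' hH))
  refine pow_le_pow_left₀ (by linarith) ?_ 2
  simp_rw [← Finset.prod_mul_distrib]
  simp_rw [Real.sqrt_prod _ fun i _ => mul_nonneg (h0 _) (h0' _)]
  rw [← Fintype.sum_pow fun p : Fin H → S × A => √(chainWeight ν Q p * chainWeight ν Q' p)]
  have hρ : 1 - δ ≤ ∑ p : Fin H → S × A, √(chainWeight ν Q p * chainWeight ν Q' p) := by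
    refine hδL.trans ?_
    rw [← sum_chainWeight ν L hH]
    exact Finset.sum_le_sum fun p _ => chainWeight_le_sqrt hL p
  calc 1 - n * δ = 1 + n * (-δ) := by ring
    _ ≤ (1 + -δ) ^ n := one_add_mul_le_pow (by linarith) n
    _ ≤ _ := pow_le_pow_left₀ (by linarith) (by linarith) n

end Paths

section DeterministicRewards

variable {S A : Type} [Fintype S] [Fintype A]

lemma forwardMass_eq_margDist (P : ℕ → S → A → S → ℝ) (d₁ : S → ℝ) (μ : ℕ → S → A → ℝ) (t : ℕ) :
    forwardMass (fun q : S × A => d₁ q.1 * μ 0 q.1 q.2)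
      (fun t q q' => P t q.1 q.2 q'.1 * μ (t + 1) q'.1 q'.2) t = margDist P d₁ μ t := by
  induction t with
  | zero => rfl
  | succ t ih =>
    funext q
    simp only [forwardMass, margDist, ih, Finset.mul_sum]
    exact Finset.sum_congr rfl fun p _ => by ring

variable [Inhabited S] [Inhabited A]

lemma pathWeight_eq_chainWeight (M : MDP S A) (μ : ℕ → S → A → ℝ) {H : ℕ}
    (p : Fin H → S × A) :
    pathWeight M μ p = chainWeight (fun q => M.d₁ q.1 * μ 0 q.1 q.2)
      (fun t q q' => M.P t q.1 q.2 q'.1 * μ (t + 1) q'.1 q'.2) p := rfl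

/-- The episode with state-action path `p` and rewards given by the function `ρ`. -/
def episodeOfPath (ρ : ℕ → S → A → ℝ) {H : ℕ} (p : Fin H → S × A) : Episode S A H :=
  (p, fun t => ρ t (p t).1 (p t).2)

variable [MeasurableSpace S] [MeasurableSpace A]

lemma le_episodeLaw_singleton [MeasurableSingletonClass S] [MeasurableSingletonClass A]
    (M : MDP S A) (μ : ℕ → S → A → ℝ) (ρ : ℕ → S → A → ℝ) {H : ℕ} (p : Fin H → S × A) :
    ENNReal.ofReal (pathWeight M μ p) ≤
      episodeLaw M μ (fun t s a => Measure.dirac (ρ t s a)) H {episodeOfPath ρ p} := by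
  rw [episodeLaw, Measure.finsetSum_apply]
  refine le_trans (le_of_eq ?_) (Finset.single_le_sum (fun _ _ => zero_le) (Finset.mem_univ p))
  rw [episodeOfPath, ← Set.singleton_prod_singleton, Measure.smul_apply, Measure.prod_prod,
    Measure.pi_singleton]
  simp

lemma sum_prod_pathWeight_le_datasetLaw [MeasurableSingletonClass S]
    [MeasurableSingletonClass A] (M : MDP S A) {μ : ℕ → S → A → ℝ} (hμ : IsPolicy μ)
    (ρ : ℕ → S → A → ℝ) {H n : ℕ} (E : Set (Dataset S A H n))
    (F : Finset (Fin n → Fin H → S × A)) (hF : ∀ x ∈ F, (fun i => episodeOfPath ρ (x i)) ∈ E) :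
    ENNReal.ofReal (∑ x ∈ F, ∏ i, pathWeight M μ (x i)) ≤
      datasetLaw M μ (fun t s a => Measure.dirac (ρ t s a)) H n E := by
  classical
  have hw : ∀ p : Fin H → S × A, 0 ≤ pathWeight M μ p := fun p =>
    chainWeight_nonneg (fun q => mul_nonneg (M.d₁_nonneg _) (hμ.1 _ _ _))
      (fun t q q' => mul_nonneg (M.P_nonneg _ _ _ _) (hμ.1 _ _ _)) p
  have hfin : ∀ p : Fin H → S × A, IsFiniteMeasure (ENNReal.ofReal (pathWeight M μ p) •
      ((Measure.dirac p).prod (Measure.pi fun t : Fin H =>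
        Measure.dirac (ρ (t : ℕ) (p t).1 (p t).2)))) :=
    fun p => Measure.smul_finite _ ENNReal.ofReal_ne_top
  have : IsFiniteMeasure (episodeLaw M μ (fun t s a => Measure.dirac (ρ t s a)) H) := by
    unfold episodeLaw
    infer_instance
  let data : (Fin n → Fin H → S × A) → Dataset S A H n := fun x i => episodeOfPath ρ (x i)
  have hinj : Function.Injective data := fun x y h => by
    funext i
    exact congrArg Prod.fst (congrFun h i)
  calc ENNReal.ofReal (∑ x ∈ F, ∏ i, pathWeight M μ (x i))
      = ∑ x ∈ F, ∏ i, ENNReal.ofReal (pathWeight M μ (x i)) := by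
        rw [ENNReal.ofReal_sum_of_nonneg fun x _ => Finset.prod_nonneg fun i _ => hw _]
        exact Finset.sum_congr rfl fun x _ => ENNReal.ofReal_prod_of_nonneg fun i _ => hw _
    _ ≤ ∑ x ∈ F, datasetLaw M μ (fun t s a => Measure.dirac (ρ t s a)) H n {data x} := by
        refine Finset.sum_le_sum fun x _ => ?_
        rw [datasetLaw, Measure.pi_singleton]
        exact Finset.prod_le_prod' fun i _ => le_episodeLaw_singleton M μ ρ (x i)
    _ = datasetLaw M μ (fun t s a => Measure.dirac (ρ t s a)) H n ↑(F.image data) := by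
        rw [← sum_measure_singleton, Finset.sum_image fun x _ y _ h => hinj h]
    _ ≤ _ := measure_mono fun D hD => by
        obtain ⟨x, hx, rfl⟩ := Finset.mem_image.1 (Finset.mem_coe.1 hD)
        exact hF x hx

end DeterministicRewards

/-- A partial matching of the state space: `partner` is an involution exchanging states of
opposite sign (unmatched states have sign `0`), and `rep` is a label shared by partners. -/
structure Pairing (S : Type) [Fintype S] [DecidableEq S] where
  partner : S → S
  sign : S → ℝ
  rep : S → S
  partner_partner : ∀ s, partner (partner s) = s
  sign_partner : ∀ s, sign (partner s) = -sign s
  sign_sq_le_one : ∀ s, sign s ^ 2 ≤ 1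
  rep_partner : ∀ s, rep (partner s) = rep s
  card_rep_le : ∀ k, (univ.filter fun s => rep s = k).card ≤ 2
  card_sub_one_le : (Fintype.card S : ℝ) - 1 ≤ ∑ s, sign s ^ 2

/-- The matching `{0, 1}, {2, 3}, …` of `Fin N`, whose last element is unmatched if `N` is odd. -/
def finPairing (N : ℕ) : Pairing (Fin N) where
  partner i :=
    if (i : ℕ) % 2 = 0 then if h : (i : ℕ) + 1 < N then ⟨i + 1, h⟩ else i
    else ⟨i - 1, by omega⟩
  sign i := if (i : ℕ) % 2 = 0 then if (i : ℕ) + 1 < N then 1 else 0 else -1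
  rep i := ⟨2 * (i / 2), by omega⟩
  partner_partner i := by
    ext
    split_ifs <;> simp_all <;> omega
  sign_partner i := by
    by_cases h0 : (i : ℕ) % 2 = 0
    · by_cases h1 : (i : ℕ) + 1 < N
      · have : ((i : ℕ) + 1) % 2 ≠ 0 := by omega
        simp [h0, h1, this]
      · simp [h0, h1]
    · have h2 : ((i : ℕ) - 1) % 2 = 0 := by omega
      have h3 : (i : ℕ) - 1 + 1 < N := by omega
      simp [h0, h2, h3]
  sign_sq_le_one i := by split_ifs <;> norm_num
  rep_partner i := by
    ext
    split_ifs <;> simp <;> omega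
  card_rep_le k := by
    have hsub : (univ.filter fun i : Fin N => (⟨2 * (i / 2), by omega⟩ : Fin N) = k).image
        (fun i : Fin N => (i : ℕ)) ⊆ {(k : ℕ), (k : ℕ) + 1} := by
      intro x hx
      simp only [Finset.mem_image, Finset.mem_filter, Finset.mem_univ, true_and, Fin.ext_iff] at hx
      simp only [Finset.mem_insert, Finset.mem_singleton]
      omega
    rw [← Finset.card_image_of_injective _ Fin.val_injective]
    exact (Finset.card_le_card hsub).trans Finset.card_le_two
  card_sub_one_le := by
    have hsq : ∀ i : Fin N, (1 : ℝ) - (if (i : ℕ) + 1 = N then 1 else 0) ≤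
        (if (i : ℕ) % 2 = 0 then if (i : ℕ) + 1 < N then (1 : ℝ) else 0 else -1) ^ 2 := by
      intro i
      have := i.2
      split_ifs <;> first | omega | norm_num
    refine le_trans ?_ (Finset.sum_le_sum fun i _ => hsq i)
    rw [Finset.sum_sub_distrib, Finset.sum_boole]
    have hcard : (univ.filter fun i : Fin N => (i : ℕ) + 1 = N).card ≤ 1 := by
      refine Finset.card_le_one.2 fun a ha b hb => ?_
      simp only [Finset.mem_filter, Finset.mem_univ, true_and] at ha hb
      ext
      omega
    have : ((univ.filter fun i : Fin N => (i : ℕ) + 1 = N).card : ℝ) ≤ 1 := by exact_mod_cast hcard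
    simp only [Finset.sum_const, Finset.card_univ, nsmul_eq_mul, mul_one]
    linarith

/-- Transport of a matching along an equivalence. -/
def Pairing.map {S S' : Type} [Fintype S] [DecidableEq S] [Fintype S'] [DecidableEq S']
    (G : Pairing S) (e : S ≃ S') : Pairing S' where
  partner s := e (G.partner (e.symm s))
  sign s := G.sign (e.symm s)
  rep s := e (G.rep (e.symm s))
  partner_partner s := by simp [G.partner_partner]
  sign_partner s := by simp [G.sign_partner]
  sign_sq_le_one s := G.sign_sq_le_one _
  rep_partner s := by simp [G.rep_partner]
  card_rep_le k := by
    refine le_trans (le_of_eq ?_) (G.card_rep_le (e.symm k))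
    refine Finset.card_equiv e.symm fun s => ?_
    simp [Equiv.eq_symm_apply]
  card_sub_one_le := by
    rw [Equiv.sum_comp e.symm fun s => G.sign s ^ 2, ← Fintype.card_congr e]
    exact G.card_sub_one_le

section HardInstance

variable {S : Type} [Fintype S] [DecidableEq S]

/-- Weight of moving from `s` to `s'` when the state is refreshed: both `s` and its partner get
weight one (an unmatched state gets weight two). -/
def Pairing.refresh (G : Pairing S) (s s' : S) : ℝ :=
  (if s' = s then 1 else 0) + if s' = G.partner s then 1 else 0

/-- Stay with probability `1 - η`; with probability `η` refresh the state within its pair, with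
relative weight `v` on the new state. -/
def Pairing.kernel (G : Pairing S) (η : ℝ) (v : S → ℝ) (s s' : S) : ℝ :=
  (1 - η) * (if s' = s then 1 else 0) + η / 2 * v s' * G.refresh s s'

namespace Pairing

variable (G : Pairing S)

lemma refresh_nonneg (s s' : S) : 0 ≤ G.refresh s s' := by
  unfold refresh
  split_ifs <;> norm_num

lemma refresh_eq (s s' : S) :
    G.refresh s s' = (if s = s' then 1 else 0) + if s = G.partner s' then 1 else 0 := by
  have h : s' = G.partner s ↔ s = G.partner s' :=
    ⟨fun h => by rw [h, G.partner_partner], fun h => by rw [h, G.partner_partner]⟩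
  simp only [refresh, h, eq_comm]

lemma kernel_nonneg {η : ℝ} (hη0 : 0 ≤ η) (hη1 : η ≤ 1) {v : S → ℝ} (hv : ∀ s, 0 ≤ v s)
    (s s' : S) : 0 ≤ G.kernel η v s s' := by
  refine add_nonneg (mul_nonneg (by linarith) (by split_ifs <;> norm_num)) ?_
  exact mul_nonneg (mul_nonneg (by linarith) (hv _)) (G.refresh_nonneg s s')

lemma sum_kernel (η : ℝ) (v : S → ℝ) (s : S) :
    ∑ s', G.kernel η v s s' = 1 - η + η / 2 * (v s + v (G.partner s)) := by
  simp only [kernel, refresh, mul_add, mul_ite, mul_one, mul_zero, Finset.sum_add_distrib,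
    Finset.sum_ite_eq', Finset.mem_univ, if_true]

lemma sum_kernel_mul (η : ℝ) (v : S → S → ℝ) (D : S → ℝ) (s' : S) :
    ∑ s, G.kernel η (v s) s s' * D s = (1 - η) * D s' +
      η / 2 * (v s' s' * D s' + v (G.partner s') s' * D (G.partner s')) := by
  simp only [kernel, refresh_eq, eq_comm (a := s'), add_mul, mul_add, mul_ite, mul_one, mul_zero,
    ite_mul, zero_mul, Finset.sum_add_distrib, Finset.sum_ite_eq', Finset.mem_univ, if_true]
  ring

lemma abs_sign_le_one (s : S) : |G.sign s| ≤ 1 := by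
  rw [← sq_le_one_iff_abs_le_one]
  exact G.sign_sq_le_one s

lemma one_add_mul_sign_nonneg {w : ℝ} (hw : |w| ≤ 1) (s : S) : 0 ≤ 1 + w * G.sign s := by
  have : |w * G.sign s| ≤ 1 := by
    rw [abs_mul]
    exact mul_le_one₀ hw (abs_nonneg _) (G.abs_sign_le_one s)
  linarith [(abs_le.1 this).1]

lemma sum_kernel_sign (η w : ℝ) (s : S) :
    ∑ s', G.kernel η (fun s' => 1 + w * G.sign s') s s' = 1 := by
  rw [sum_kernel, G.sign_partner]
  ring

lemma kernel_sq_le {η : ℝ} (hη0 : 0 ≤ η) (hη1 : η ≤ 1) {w : ℝ} (hw : |w| ≤ 1) (s s' : S) :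
    G.kernel η (fun _ => 1 - w ^ 2) s s' ^ 2 ≤
      G.kernel η (fun s' => 1 + w * G.sign s') s s' *
        G.kernel η (fun s' => 1 + -w * G.sign s') s s' := by
  unfold kernel
  have hX : 0 ≤ (1 - η) * (if s' = s then (1 : ℝ) else 0) :=
    mul_nonneg (by linarith) (by split_ifs <;> norm_num)
  have hY : 0 ≤ η / 2 * G.refresh s s' := mul_nonneg (by linarith) (G.refresh_nonneg s s')
  set X := (1 - η) * (if s' = s then (1 : ℝ) else 0)
  set Y := η / 2 * G.refresh s s' with hYdef
  have hw2 : w ^ 2 ≤ 1 := (sq_le_one_iff_abs_le_one w).2 hw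
  have hu := G.sign_sq_le_one s'
  have e : ∀ v : ℝ, η / 2 * v * G.refresh s s' = v * Y := fun v => by rw [hYdef]; ring
  simp only [e]
  have h1 : 0 ≤ Y ^ 2 * w ^ 2 * (1 - G.sign s' ^ 2) :=
    mul_nonneg (by positivity) (by linarith)
  have h2 : 0 ≤ Y ^ 2 * w ^ 2 * (1 - w ^ 2) := mul_nonneg (by positivity) (by linarith)
  have h3 : 0 ≤ X * Y * w ^ 2 := by positivity
  nlinarith

end Pairing

end HardInstance

/-- The value at `(t, k)` of the sign pattern `θ`, extended by zero beyond the horizon. -/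
def bitSign {S : Type} {H : ℕ} (θ : Fin H × S → Bool) (t : ℕ) (k : S) : ℝ :=
  if h : t < H then if θ (⟨t, h⟩, k) then 1 else -1 else 0

lemma abs_bitSign_le_one {S : Type} {H : ℕ} (θ : Fin H × S → Bool) (t : ℕ) (k : S) :
    |bitSign θ t k| ≤ 1 := by
  unfold bitSign
  split_ifs <;> norm_num

lemma bitSign_update {S : Type} [DecidableEq S] {H : ℕ} (θ : Fin H × S → Bool)
    (i : Fin H × S) (t : ℕ) (k : S) :
    bitSign (Function.update θ i (!θ i)) t k =
      if t = i.1 ∧ k = i.2 then -bitSign θ t k else bitSign θ t k := by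
  obtain ⟨j, l⟩ := i
  by_cases ht : t < H
  · by_cases h : t = j ∧ k = l
    · obtain ⟨rfl, rfl⟩ := h
      cases hb : θ (j, k) <;> simp [bitSign, hb]
    · have hne : ((⟨t, ht⟩, k) : Fin H × S) ≠ (j, l) := by
        rintro heq
        rw [Prod.mk.injEq, Fin.ext_iff] at heq
        exact h heq
      simp only [bitSign, ht, dif_pos, Function.update_of_ne hne, if_neg h]
  · have : bitSign θ t k = 0 := by simp [bitSign, ht]
    have h' : t ≠ j := by
      rintro rfl
      exact ht j.2
    simp [bitSign, ht]

lemma abs_tilt_le_one {S A : Type} {τ : ℝ} {c : A → ℝ} (hτ0 : 0 ≤ τ) (hτ1 : τ ≤ 1)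
    (hc : ∀ a, |c a| ≤ 1) {H : ℕ} (θ : Fin H × S → Bool) (t : ℕ) (k : S) (a : A) :
    |τ * bitSign θ t k * c a| ≤ 1 := by
  rw [abs_mul, abs_mul, abs_of_nonneg hτ0]
  exact mul_le_one₀ (mul_le_one₀ hτ1 (abs_nonneg _) (abs_bitSign_le_one θ t k))
    (abs_nonneg _) (hc a)

/-- Indicator that the sign patterns `θ` and `θ'` differ at `(t, k)`. -/
def mismatch {S : Type} {H : ℕ} (θ θ' : Fin H × S → Bool) (t : ℕ) (k : S) : ℝ :=
  if h : t < H then if θ (⟨t, h⟩, k) ≠ θ' (⟨t, h⟩, k) then 1 else 0 else 0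

lemma mismatch_nonneg {S : Type} {H : ℕ} (θ θ' : Fin H × S → Bool) (t : ℕ) (k : S) :
    0 ≤ mismatch θ θ' t k := by
  unfold mismatch
  split_ifs <;> norm_num

lemma bitSign_mul_self_sub {S : Type} {H : ℕ} (θ θ' : Fin H × S → Bool) (t : ℕ) (k : S) :
    bitSign θ t k * bitSign θ t k - bitSign θ' t k * bitSign θ t k = 2 * mismatch θ θ' t k := by
  by_cases ht : t < H
  · cases h : θ (⟨t, ht⟩, k) <;> cases h' : θ' (⟨t, ht⟩, k) <;>
      norm_num [bitSign, mismatch, ht, h, h']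
  · simp [bitSign, mismatch, ht]

/-- State marginal at time `t` under the deterministic policy `g`. -/
def stateDist {S A : Type} [Fintype S] (P : ℕ → S → A → S → ℝ) (d₁ : S → ℝ) (g : ℕ → S → A) :
    ℕ → S → ℝ
  | 0 => d₁
  | t + 1 => fun s' => ∑ s, P t s (g t s) s' * stateDist P d₁ g t s

lemma margDist_detToPolicy {S A : Type} [Fintype S] [Fintype A] [DecidableEq A]
    (P : ℕ → S → A → S → ℝ) (d₁ : S → ℝ) (g : ℕ → S → A) (t : ℕ) (q : S × A) :
    margDist P d₁ (detToPolicy g) t q = detToPolicy g t q.1 q.2 * stateDist P d₁ g t q.1 := by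
  induction t generalizing q with
  | zero => simp [margDist, stateDist, mul_comm]
  | succ t ih =>
    simp only [margDist, stateDist, ih, Fintype.sum_prod_type]
    congr 1
    refine Finset.sum_congr rfl fun s _ => ?_
    simp [detToPolicy]

lemma polValue_detToPolicy {S A : Type} [Fintype S] [Fintype A] [DecidableEq A]
    (P : ℕ → S → A → S → ℝ) (ρ : S → ℝ) (d₁ : S → ℝ) (g : ℕ → S → A) (H : ℕ) :
    polValue P (fun _ s _ => ρ s) d₁ (detToPolicy g) H =
      ∑ t ∈ Finset.range H, ∑ s, stateDist P d₁ g t s * ρ s := by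
  refine Finset.sum_congr rfl fun t _ => ?_
  simp only [margDist_detToPolicy, Fintype.sum_prod_type]
  refine Finset.sum_congr rfl fun s _ => ?_
  simp [detToPolicy]

section Values

variable {S : Type} [Fintype S] [DecidableEq S] (G : Pairing S)

namespace Pairing

/-- Transitions of the hard instance: at `(t, s, a)` the refreshed state is tilted by
`τ θ(t, rep s) c(a)` towards positive states. -/
def hardP {A : Type} (η τ : ℝ) (c : A → ℝ) {H : ℕ} (θ : Fin H × S → Bool)
    (t : ℕ) (s : S) (a : A) (s' : S) : ℝ :=
  G.kernel η (fun s' => 1 + τ * bitSign θ t (G.rep s) * c a * G.sign s') s s'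

lemma hardP_nonneg {A : Type} {η τ : ℝ} {c : A → ℝ} (hη0 : 0 ≤ η) (hη1 : η ≤ 1) (hτ0 : 0 ≤ τ)
    (hτ1 : τ ≤ 1) (hc : ∀ a, |c a| ≤ 1) {H : ℕ} (θ : Fin H × S → Bool) (t : ℕ) (s : S) (a : A)
    (s' : S) : 0 ≤ G.hardP η τ c θ t s a s' :=
  G.kernel_nonneg hη0 hη1
    (G.one_add_mul_sign_nonneg (abs_tilt_le_one hτ0 hτ1 hc θ t (G.rep s) a)) s s'

lemma sum_hardP {A : Type} (η τ : ℝ) (c : A → ℝ) {H : ℕ} (θ : Fin H × S → Bool) (t : ℕ) (s : S)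
    (a : A) : ∑ s', G.hardP η τ c θ t s a s' = 1 :=
  G.sum_kernel_sign η _ s

variable {A : Type} {η τ : ℝ} {c : A → ℝ} {H : ℕ}

/-- If the action score chosen by `g` agrees on partners, every pair keeps its total mass. -/
lemma stateDist_add_partner (θ : Fin H × S → Bool) {g : ℕ → S → A} {d : ℝ}
    (hg : ∀ t s, g t (G.partner s) = g t s) (t : ℕ) (s : S) :
    stateDist (G.hardP η τ c θ) (fun _ => d) g t s +
      stateDist (G.hardP η τ c θ) (fun _ => d) g t (G.partner s) = 2 * d := by
  induction t with
  | zero => simp only [stateDist]; ring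
  | succ t ih =>
    simp only [stateDist, hardP]
    rw [G.sum_kernel_mul, G.sum_kernel_mul]
    simp only [G.partner_partner, G.rep_partner, G.sign_partner, hg]
    rw [← ih]
    ring

lemma stateDist_succ (θ : Fin H × S → Bool) {g : ℕ → S → A} {d : ℝ}
    (hg : ∀ t s, g t (G.partner s) = g t s) (t : ℕ) (s : S) :
    stateDist (G.hardP η τ c θ) (fun _ => d) g (t + 1) s =
      (1 - η) * stateDist (G.hardP η τ c θ) (fun _ => d) g t s +
        η * d * (1 + τ * bitSign θ t (G.rep s) * c (g t s) * G.sign s) := by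
  have h := G.stateDist_add_partner (η := η) (τ := τ) (c := c) θ (d := d) hg t s
  conv_lhs => simp only [stateDist, hardP]
  rw [G.sum_kernel_mul, G.rep_partner, hg, ← mul_add, h]
  ring

lemma sum_stateDist (θ : Fin H × S → Bool) {g : ℕ → S → A} {d : ℝ}
    (hg : ∀ t s, g t (G.partner s) = g t s) (t : ℕ) :
    ∑ s, stateDist (G.hardP η τ c θ) (fun _ => d) g t s = Fintype.card S * d := by
  have h : ∑ s, stateDist (G.hardP η τ c θ) (fun _ => d) g t (G.partner s) =
      ∑ s, stateDist (G.hardP η τ c θ) (fun _ => d) g t s :=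
    Equiv.sum_comp (Function.Involutive.toPerm G.partner G.partner_partner) _
  have h2 := Finset.sum_congr rfl fun s (_ : s ∈ univ) =>
    G.stateDist_add_partner (η := η) (τ := τ) (c := c) θ (d := d) hg t s
  rw [Finset.sum_add_distrib, h] at h2
  simp only [Finset.sum_const, Finset.card_univ, nsmul_eq_mul] at h2
  linarith

/-- Following the signs of `θ`, the signed mass in the instance `θ` exceeds that in `θ'`. -/
lemma le_sign_mul_stateDist_sub (θ θ' : Fin H × S → Bool) {g : ℕ → S → A} {d : ℝ}
    (hη : 0 ≤ η) (hτ : 0 ≤ τ) (hd : 0 ≤ d) (hg : ∀ t s, g t (G.partner s) = g t s)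
    (hgc : ∀ t < H, ∀ s, c (g t s) = bitSign θ t (G.rep s)) (hηH : η * H ≤ 1) {t : ℕ}
    (ht : t ≤ H) (s : S) :
    (1 - η * t) * (2 * η * τ * d * G.sign s ^ 2) *
        ∑ j ∈ Finset.range t, mismatch θ θ' j (G.rep s) ≤
      G.sign s * (stateDist (G.hardP η τ c θ) (fun _ => d) g t s -
        stateDist (G.hardP η τ c θ') (fun _ => d) g t s) := by
  induction t with
  | zero => simp [stateDist]
  | succ t ih =>
    rw [G.stateDist_succ θ hg, G.stateDist_succ θ' hg, hgc t (by omega), Finset.sum_range_succ]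
    have ih' := ih (by omega)
    have hm := mismatch_nonneg θ θ' t (G.rep s)
    have hN : 0 ≤ ∑ j ∈ Finset.range t, mismatch θ θ' j (G.rep s) :=
      Finset.sum_nonneg fun j _ => mismatch_nonneg θ θ' j _
    have hb := bitSign_mul_self_sub θ θ' t (G.rep s)
    set N := ∑ j ∈ Finset.range t, mismatch θ θ' j (G.rep s)
    set m := mismatch θ θ' t (G.rep s)
    set D := stateDist (G.hardP η τ c θ) (fun _ => d) g t s
    set D' := stateDist (G.hardP η τ c θ') (fun _ => d) g t s
    set b := bitSign θ t (G.rep s)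
    set b' := bitSign θ' t (G.rep s)
    have ha : 0 ≤ 2 * η * τ * d * G.sign s ^ 2 := by positivity
    set a := 2 * η * τ * d * G.sign s ^ 2 with hadef
    have hη1 : η ≤ 1 := by
      have : (1 : ℝ) ≤ H := by exact_mod_cast (by omega : 1 ≤ H)
      nlinarith
    have hstep : G.sign s * ((1 - η) * D + η * d * (1 + τ * b * b * G.sign s) -
        ((1 - η) * D' + η * d * (1 + τ * b' * b * G.sign s))) =
        (1 - η) * (G.sign s * (D - D')) + a * m := by
      have : a * m = η * τ * d * G.sign s ^ 2 * (b * b - b' * b) := by rw [hb, hadef]; ring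
      rw [this]
      ring
    rw [hstep]
    have h1 := mul_le_mul_of_nonneg_left ih' (sub_nonneg.2 hη1)
    have h2 : 0 ≤ η * t := by positivity
    push_cast
    nlinarith [mul_nonneg (mul_nonneg h2 hη) (mul_nonneg ha hN),
      mul_nonneg (add_nonneg h2 hη) (mul_nonneg ha hm)]

/-- Weight of the bit `i = (j, k)` in the loss: number of times after `j`, times the number of
matched states labelled `k`. -/
def bitWeight (H : ℕ) (i : Fin H × S) : ℝ :=
  (∑ t ∈ Finset.range H, if (i.1 : ℕ) < t then (1 : ℝ) else 0) *
    ∑ s, if G.rep s = i.2 then G.sign s ^ 2 else 0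

lemma bitWeight_nonneg (i : Fin H × S) : 0 ≤ G.bitWeight H i :=
  mul_nonneg (Finset.sum_nonneg fun t _ => by split_ifs <;> norm_num)
    (Finset.sum_nonneg fun s _ => by split_ifs <;> positivity)

lemma sum_mul_bitWeight (φ : ℕ → S → ℝ) :
    ∑ i : Fin H × S, φ i.1 i.2 * G.bitWeight H i =
      ∑ t ∈ Finset.range H, ∑ s, G.sign s ^ 2 * ∑ j ∈ Finset.range t, φ j (G.rep s) := by
  have hinner : ∀ t ∈ Finset.range H, ∀ s, ∑ j ∈ Finset.range t, φ j (G.rep s) =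
      ∑ j : Fin H, if (j : ℕ) < t then φ j (G.rep s) else 0 := by
    intro t ht s
    rw [Fin.sum_univ_eq_sum_range (fun j => if j < t then φ j (G.rep s) else 0) H,
      ← Finset.sum_filter]
    congr 1
    ext j
    simp only [Finset.mem_range, Finset.mem_filter] at ht ⊢
    omega
  have hleft : ∀ j : Fin H, ∑ k, φ j k * G.bitWeight H (j, k) =
      ∑ t ∈ Finset.range H, ∑ s, if (j : ℕ) < t then G.sign s ^ 2 * φ j (G.rep s) else 0 := by
    intro j
    have hk : ∑ k, φ j k * ∑ s, (if G.rep s = k then G.sign s ^ 2 else 0) =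
        ∑ s, G.sign s ^ 2 * φ j (G.rep s) := by
      simp only [Finset.mul_sum]
      rw [Finset.sum_comm]
      refine Finset.sum_congr rfl fun s _ => ?_
      simp [mul_comm]
    calc ∑ k, φ j k * G.bitWeight H (j, k)
        = (∑ t ∈ Finset.range H, if (j : ℕ) < t then (1 : ℝ) else 0) *
          ∑ k, φ j k * ∑ s, (if G.rep s = k then G.sign s ^ 2 else 0) := by
          rw [Finset.mul_sum]
          exact Finset.sum_congr rfl fun k _ => by rw [bitWeight]; ring
      _ = _ := by
          rw [hk, Finset.sum_mul]
          refine Finset.sum_congr rfl fun t _ => ?_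
          split_ifs <;> simp
  rw [Fintype.sum_prod_type]
  simp only [hleft]
  rw [Finset.sum_comm]
  refine Finset.sum_congr rfl fun t ht => ?_
  rw [Finset.sum_comm]
  refine Finset.sum_congr rfl fun s _ => ?_
  rw [hinner t ht s, Finset.mul_sum]
  exact Finset.sum_congr rfl fun j _ => by split_ifs <;> simp

lemma sum_bitWeight :
    ∑ i, G.bitWeight H i = H * (H - 1) / 2 * ∑ s, G.sign s ^ 2 := by
  have h := G.sum_mul_bitWeight (H := H) fun _ _ => 1
  simp only [one_mul, Finset.sum_const, Finset.card_range, nsmul_eq_mul, mul_one] at h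
  rw [h]
  simp only [← Finset.sum_mul]
  rw [← Finset.mul_sum]
  have hg : (∑ t ∈ Finset.range H, (t : ℝ)) * 2 = H * (H - 1) := by
    clear h
    induction H with
    | zero => simp
    | succ H ih => rw [Finset.sum_range_succ, add_mul, ih]; push_cast; ring
  rw [← hg]
  ring

/-- Following the signs of `θ`, the values of the instances `θ` and `θ'` differ by at least a
multiple of the weighted Hamming distance between `θ` and `θ'`. -/
lemma le_polValue_sub [Fintype A] [DecidableEq A] (θ θ' : Fin H × S → Bool) {g : ℕ → S → A}
    {d : ℝ} (hη : 0 ≤ η) (hτ : 0 ≤ τ) (hd : 0 ≤ d) (hg : ∀ t s, g t (G.partner s) = g t s)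
    (hgc : ∀ t < H, ∀ s, c (g t s) = bitSign θ t (G.rep s)) (hηH : η * H ≤ 1 / 2) :
    η * τ * d / 2 * ∑ i, (if θ i ≠ θ' i then G.bitWeight H i else 0) ≤
      polValue (G.hardP η τ c θ) (fun _ s _ => (1 + G.sign s) / 2) (fun _ => d)
          (detToPolicy g) H -
        polValue (G.hardP η τ c θ') (fun _ s _ => (1 + G.sign s) / 2) (fun _ => d)
          (detToPolicy g) H := by
  have hham : ∑ i, (if θ i ≠ θ' i then G.bitWeight H i else 0) =
      ∑ t ∈ Finset.range H, ∑ s, G.sign s ^ 2 *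
        ∑ j ∈ Finset.range t, mismatch θ θ' j (G.rep s) := by
    rw [← G.sum_mul_bitWeight]
    refine Finset.sum_congr rfl fun i _ => ?_
    simp only [mismatch, i.1.2, dif_pos, Fin.eta, Prod.mk.eta]
    split_ifs <;> simp
  rw [hham, polValue_detToPolicy, polValue_detToPolicy, ← Finset.sum_sub_distrib, Finset.mul_sum]
  refine Finset.sum_le_sum fun t ht => ?_
  have htH : t < H := Finset.mem_range.1 ht
  have hsum := (G.sum_stateDist (η := η) (τ := τ) (c := c) θ (d := d) hg t).trans
    (G.sum_stateDist (η := η) (τ := τ) (c := c) θ' (d := d) hg t).symm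
  have hval : ∑ s, stateDist (G.hardP η τ c θ) (fun _ => d) g t s * ((1 + G.sign s) / 2) -
      ∑ s, stateDist (G.hardP η τ c θ') (fun _ => d) g t s * ((1 + G.sign s) / 2) =
      ∑ s, 1 / 2 * (G.sign s * (stateDist (G.hardP η τ c θ) (fun _ => d) g t s -
        stateDist (G.hardP η τ c θ') (fun _ => d) g t s)) := by
    have h0 := sub_eq_zero.2 hsum
    rw [← Finset.sum_sub_distrib] at h0 ⊢
    rw [← sub_eq_zero, ← Finset.sum_sub_distrib, ← mul_zero (1 / 2 : ℝ), ← h0, Finset.mul_sum]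
    exact Finset.sum_congr rfl fun s _ => by ring
  rw [hval, Finset.mul_sum]
  refine Finset.sum_le_sum fun s _ => ?_
  have h := G.le_sign_mul_stateDist_sub θ θ' hη hτ hd hg hgc (by linarith) htH.le s
  have hηt : η * t ≤ 1 / 2 :=
    (mul_le_mul_of_nonneg_left (by exact_mod_cast htH.le) hη).trans hηH
  have hN : 0 ≤ 2 * η * τ * d * G.sign s ^ 2 *
      ∑ j ∈ Finset.range t, mismatch θ θ' j (G.rep s) :=
    mul_nonneg (by positivity) (Finset.sum_nonneg fun j _ => mismatch_nonneg θ θ' j _)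
  nlinarith [mul_nonneg (sub_nonneg.2 hηt) hN]

end Pairing

end Values

section LoggingPolicy

variable {A : Type} [DecidableEq A]

/-- Score `1` for the action `a₁`, `-1` for `a₂` and `0` for all other actions. -/
def actionScore (a₁ a₂ a : A) : ℝ := (if a = a₁ then 1 else 0) - if a = a₂ then 1 else 0

lemma abs_actionScore_le_one (a₁ a₂ a : A) : |actionScore a₁ a₂ a| ≤ 1 := by
  unfold actionScore
  split_ifs <;> norm_num

variable [Fintype A]

/-- Logging policy giving probability `x` to every action and the remaining mass to `a₃`. -/
def logPolicy (x : ℝ) (a₃ a : A) : ℝ :=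
  x + if a = a₃ then 1 - Fintype.card A * x else 0

lemma le_logPolicy {x : ℝ} (hx : Fintype.card A * x ≤ 1) (a₃ a : A) : x ≤ logPolicy x a₃ a := by
  unfold logPolicy
  split_ifs <;> linarith

lemma sum_logPolicy (x : ℝ) (a₃ : A) : ∑ a, logPolicy x a₃ a = 1 := by
  simp [logPolicy, Finset.sum_add_distrib]

lemma sum_actionScore_mul_logPolicy (x : ℝ) {a₁ a₂ a₃ : A} (h₁ : a₁ ≠ a₃) (h₂ : a₂ ≠ a₃) :
    ∑ a, actionScore a₁ a₂ a * logPolicy x a₃ a = 0 := by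
  simp [actionScore, sub_mul, Finset.sum_sub_distrib, logPolicy, h₁, h₂]

lemma sum_actionScore_sq_mul_logPolicy (x : ℝ) {a₁ a₂ a₃ : A} (h₁₂ : a₁ ≠ a₂) (h₁ : a₁ ≠ a₃)
    (h₂ : a₂ ≠ a₃) : ∑ a, actionScore a₁ a₂ a ^ 2 * logPolicy x a₃ a = 2 * x := by
  have h : ∀ a, actionScore a₁ a₂ a ^ 2 = (if a = a₁ then 1 else 0) + if a = a₂ then 1 else 0 := by
    intro a
    by_cases ha : a = a₁
    · subst ha
      simp [actionScore, h₁₂]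
    · by_cases hb : a = a₂
      · subst hb
        simp [actionScore, h₁₂.symm]
      · simp [actionScore, ha, hb]
  simp [h, add_mul, Finset.sum_add_distrib, logPolicy, h₁, h₂]
  ring

end LoggingPolicy

namespace Pairing

variable {S A : Type} [Fintype S] [DecidableEq S] (G : Pairing S)
  {η τ : ℝ} {c μ : A → ℝ} {H : ℕ}

/-- Transition weights of the state-action chain of the hard instance under the logging policy. -/
def hardChain (η τ : ℝ) (c μ : A → ℝ) (θ : Fin H × S → Bool) (t : ℕ) (q q' : S × A) : ℝ :=
  G.hardP η τ c θ t q.1 q.2 q'.1 * μ q'.2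

/-- Common lower bound for the geometric means of the transition weights of two instances that
differ exactly in the bit `i`. -/
def meanChain (η τ : ℝ) (c μ : A → ℝ) (θ : Fin H × S → Bool) (i : Fin H × S) (t : ℕ)
    (q q' : S × A) : ℝ :=
  (if t = i.1 ∧ G.rep q.1 = i.2 then
    G.kernel η (fun _ => 1 - (τ * bitSign θ t (G.rep q.1) * c q.2) ^ 2) q.1 q'.1
  else G.hardP η τ c θ t q.1 q.2 q'.1) * μ q'.2

lemma meanChain_sq_le (hη0 : 0 ≤ η) (hη1 : η ≤ 1) (hτ0 : 0 ≤ τ) (hτ1 : τ ≤ 1)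
    (hc : ∀ a, |c a| ≤ 1) (θ : Fin H × S → Bool) (i : Fin H × S) (t : ℕ)
    (q q' : S × A) :
    G.meanChain η τ c μ θ i t q q' ^ 2 ≤ G.hardChain η τ c μ θ t q q' *
      G.hardChain η τ c μ (Function.update θ i (!θ i)) t q q' := by
  simp only [meanChain, hardChain, hardP, bitSign_update]
  split_ifs with h
  · have hk := G.kernel_sq_le hη0 hη1 (abs_tilt_le_one hτ0 hτ1 hc θ t (G.rep q.1) q.2) q.1 q'.1
    simp only [mul_neg, neg_mul] at hk ⊢
    nlinarith [mul_le_mul_of_nonneg_left hk (sq_nonneg (μ q'.2))]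
  · exact le_of_eq (by ring)

variable [Fintype A]

/-- If the action scores average to zero under the logging policy, a uniform state distribution is
stationary. -/
lemma margDist_hardP (θ : Fin H × S → Bool) (hμ1 : ∑ a, μ a = 1) (hcμ : ∑ a, c a * μ a = 0)
    (d : ℝ) (t : ℕ) (q : S × A) :
    margDist (G.hardP η τ c θ) (fun _ => d) (fun _ _ a => μ a) t q = d * μ q.2 := by
  induction t generalizing q with
  | zero => rfl
  | succ t ih =>
    obtain ⟨s', b⟩ := q
    simp only [margDist, ih]
    rw [Fintype.sum_prod_type]
    have hs : ∀ s, ∑ a, G.hardP η τ c θ t s a s' * (d * μ a) =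
        G.kernel η (fun _ => 1) s s' * d := by
      intro s
      have h : ∀ a, G.hardP η τ c θ t s a s' * (d * μ a) =
          G.kernel η (fun _ => 1) s s' * d * μ a +
            η / 2 * (τ * bitSign θ t (G.rep s)) * G.sign s' * G.refresh s s' * d *
              (c a * μ a) := by
        intro a
        simp only [hardP, kernel]
        ring
      simp only [h, Finset.sum_add_distrib, ← Finset.mul_sum, hμ1, hcμ]
      ring
    have h := G.sum_kernel_mul η (fun _ _ => 1) (fun _ => d) s'
    simp only [hs, h]
    ring

lemma sum_hardChain (hμ1 : ∑ a, μ a = 1) (θ : Fin H × S → Bool) (t : ℕ) (q : S × A) :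
    ∑ q', G.hardChain η τ c μ θ t q q' = 1 := by
  simp only [hardChain, Fintype.sum_prod_type, ← Finset.mul_sum, hμ1, mul_one, sum_hardP]

lemma le_sum_forwardMass_meanChain (hη0 : 0 ≤ η) (hη1 : η ≤ 1) (hτ0 : 0 ≤ τ) (hτ1 : τ ≤ 1)
    (hc : ∀ a, |c a| ≤ 1) (hμ0 : ∀ a, 0 ≤ μ a) (hμ1 : ∑ a, μ a = 1) (hcμ : ∑ a, c a * μ a = 0)
    {d : ℝ} (hd : 0 ≤ d) (hdS : Fintype.card S * d = 1) (θ : Fin H × S → Bool)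
    (i : Fin H × S) (t : ℕ) :
    1 - 2 * d * η * τ ^ 2 * ∑ a, c a ^ 2 * μ a ≤
      ∑ q, forwardMass (fun q => d * μ q.2) (G.meanChain η τ c μ θ i) t q := by
  have hbit : ∀ k, bitSign θ i.1 k ^ 2 = 1 := by
    intro k
    simp only [bitSign, i.1.2, dif_pos]
    split_ifs <;> norm_num
  have hfwd : forwardMass (fun q : S × A => d * μ q.2) (G.hardChain η τ c μ θ) i.1 =
      fun q => d * μ q.2 := by
    funext q
    rw [← G.margDist_hardP (η := η) (τ := τ) θ hμ1 hcμ d i.1 q, ← forwardMass_eq_margDist]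
    rfl
  have hmass := one_sub_le_sum_forwardMass (ν := fun q : S × A => d * μ q.2)
    (Q := G.hardChain η τ c μ θ) (L := G.meanChain η τ c μ θ i) (j := i.1)
    (h := fun q => if G.rep q.1 = i.2 then η * τ ^ 2 * c q.2 ^ 2 else 0)
    (fun q => mul_nonneg hd (hμ0 _))
    (by
      simp only [Fintype.sum_prod_type, ← Finset.mul_sum, hμ1, mul_one, Finset.sum_const,
        Finset.card_univ, nsmul_eq_mul]
      linarith)
    (fun t q q' => mul_nonneg (G.hardP_nonneg hη0 hη1 hτ0 hτ1 hc θ t _ _ _) (hμ0 _))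
    (G.sum_hardChain hμ1 θ)
    (fun t ht => by
      funext q q'
      simp [meanChain, hardChain, ht])
    (fun q => by
      by_cases h : G.rep q.1 = i.2
      · simp only [meanChain, h, and_self, if_true, Fintype.sum_prod_type, ← Finset.mul_sum, hμ1,
          mul_one, sum_kernel, mul_pow, hbit]
        ring
      · simp only [meanChain, h, and_false, if_false, Fintype.sum_prod_type, ← Finset.mul_sum,
          hμ1, mul_one, sum_hardP, sub_zero])
    (fun q => by split_ifs <;> positivity) t
  refine le_trans ?_ hmass
  rw [hfwd]
  have hcs : 0 ≤ ∑ a, c a ^ 2 * μ a :=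
    Finset.sum_nonneg fun a _ => mul_nonneg (sq_nonneg _) (hμ0 a)
  have hdrop : ∑ q : S × A, (if G.rep q.1 = i.2 then η * τ ^ 2 * c q.2 ^ 2 else 0) * (d * μ q.2) =
      (univ.filter fun s => G.rep s = i.2).card * (d * η * τ ^ 2 * ∑ a, c a ^ 2 * μ a) := by
    rw [Fintype.sum_prod_type, ← nsmul_eq_mul, ← Finset.sum_const, Finset.sum_filter]
    refine Finset.sum_congr rfl fun s _ => ?_
    split_ifs
    · rw [Finset.mul_sum]
      exact Finset.sum_congr rfl fun a _ => by ring
    · simp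
  rw [hdrop]
  have hcard : ((univ.filter fun s => G.rep s = i.2).card : ℝ) ≤ 2 := by
    exact_mod_cast G.card_rep_le i.2
  have h0 : 0 ≤ d * η * τ ^ 2 * ∑ a, c a ^ 2 * μ a := by positivity
  nlinarith [mul_le_mul_of_nonneg_right hcard h0]

/-- The hard instance with sign pattern `θ`. -/
def hardMDP (hη0 : 0 ≤ η) (hη1 : η ≤ 1) (hτ0 : 0 ≤ τ) (hτ1 : τ ≤ 1) (hc : ∀ a, |c a| ≤ 1)
    {d : ℝ} (hd : 0 ≤ d) (hdS : Fintype.card S * d = 1) (θ : Fin H × S → Bool) : MDP S A where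
  P := G.hardP η τ c θ
  P_nonneg := G.hardP_nonneg hη0 hη1 hτ0 hτ1 hc θ
  P_sum := G.sum_hardP η τ c θ
  r _ s _ := (1 + G.sign s) / 2
  r_nonneg _ s _ := by linarith [(abs_le.1 (G.abs_sign_le_one s)).1]
  r_le_one _ s _ := by linarith [(abs_le.1 (G.abs_sign_le_one s)).2]
  d₁ _ := d
  d₁_nonneg _ := hd
  d₁_sum := by simpa using hdS

end Pairing

lemma validReward_dirac {S A : Type} [Fintype S] [Fintype A] (M : MDP S A) :
    ValidReward M fun t s a => Measure.dirac (M.r t s a) := fun t s a => by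
  refine ⟨inferInstance, ?_, integral_dirac _ _⟩
  rw [Measure.dirac_apply' _ measurableSet_Icc.compl]
  simp [M.r_nonneg t s a, M.r_le_one t s a]

/-- Deterministic policy playing `a₁` where `σ` is positive and `a₂` where it is negative. -/
def Pairing.signPolicy {S A : Type} [Fintype S] [DecidableEq S] (G : Pairing S) (a₁ a₂ : A)
    {H : ℕ} (σ : Fin H × S → Bool) (t : ℕ) (s : S) : A :=
  if 0 < bitSign σ t (G.rep s) then a₁ else a₂

lemma Pairing.actionScore_signPolicy {S A : Type} [Fintype S] [DecidableEq S] [DecidableEq A]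
    (G : Pairing S) {a₁ a₂ : A} (h : a₁ ≠ a₂) {H : ℕ} (σ : Fin H × S → Bool) {t : ℕ} (ht : t < H)
    (s : S) : actionScore a₁ a₂ (G.signPolicy a₁ a₂ σ t s) = bitSign σ t (G.rep s) := by
  cases hb : σ (⟨t, ht⟩, G.rep s) <;>
    norm_num [signPolicy, actionScore, bitSign, ht, hb, h, h.symm]

lemma isPolicy_logPolicy (S : Type) {A : Type} [Fintype A] [DecidableEq A] {x : ℝ} (hx0 : 0 ≤ x)
    (hx : Fintype.card A * x ≤ 1) (a₃ : A) : IsPolicy fun (_ : ℕ) (_ : S) => logPolicy x a₃ :=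
  ⟨fun _ _ a => hx0.trans (le_logPolicy hx a₃ a), fun _ _ => sum_logPolicy x a₃⟩

lemma Pairing.signPolicy_partner {S A : Type} [Fintype S] [DecidableEq S] (G : Pairing S)
    (a₁ a₂ : A) {H : ℕ} (σ : Fin H × S → Bool) (t : ℕ) (s : S) :
    G.signPolicy a₁ a₂ σ t (G.partner s) = G.signPolicy a₁ a₂ σ t s := by
  simp only [signPolicy, G.rep_partner]

section

variable {S A : Type} [Fintype S] [Inhabited S] [Fintype A] [Inhabited A]
  {η τ d : ℝ} {c μ : A → ℝ} {H : ℕ}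

lemma sum_prod_pathWeight_eq_one (M : MDP S A) {μ : ℕ → S → A → ℝ} (hμ : IsPolicy μ) {n : ℕ}
    (hH : 0 < H) : ∑ x : Fin n → Fin H → S × A, ∏ i, pathWeight M μ (x i) = 1 := by
  simp only [pathWeight_eq_chainWeight]
  refine sum_prod_chainWeight_eq_one ?_ (fun t q => ?_) hH
  · simp only [Fintype.sum_prod_type, ← Finset.mul_sum, hμ.2, mul_one, M.d₁_sum]
  · simp only [Fintype.sum_prod_type, ← Finset.mul_sum, hμ.2, mul_one, M.P_sum]

lemma prod_pathWeight_nonneg (M : MDP S A) {μ : ℕ → S → A → ℝ} (hμ : IsPolicy μ) {n : ℕ}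
    (x : Fin n → Fin H → S × A) : 0 ≤ ∏ i, pathWeight M μ (x i) :=
  Finset.prod_nonneg fun i _ =>
    chainWeight_nonneg (fun _ => mul_nonneg (M.d₁_nonneg _) (hμ.1 _ _ _))
      (fun _ _ _ => mul_nonneg (M.P_nonneg _ _ _ _) (hμ.1 _ _ _)) (x i)

/-- Flipping one bit of the sign pattern leaves the laws of the state-action paths of `n` episodes
overlapping by at least `1 / 4` when `n` is small. -/
lemma Pairing.quarter_le_sum_min_prod_pathWeight [DecidableEq S] (G : Pairing S) (hη0 : 0 ≤ η) (hη1 : η ≤ 1)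
    (hτ0 : 0 ≤ τ) (hτ1 : τ ≤ 1) (hc : ∀ a, |c a| ≤ 1) (hd : 0 ≤ d)
    (hdS : Fintype.card S * d = 1) (hμ0 : ∀ a, 0 ≤ μ a) (hμ1 : ∑ a, μ a = 1)
    (hcμ : ∑ a, c a * μ a = 0) (hH : 0 < H) {n : ℕ}
    (hδ : 2 * d * η * τ ^ 2 * ∑ a, c a ^ 2 * μ a ≤ 1)
    (hn : n * (2 * d * η * τ ^ 2 * ∑ a, c a ^ 2 * μ a) ≤ 1 / 8)
    (θ : Fin H × S → Bool) (i : Fin H × S) :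
    1 / 4 ≤ ∑ x : Fin n → Fin H → S × A,
      min (∏ j, pathWeight (G.hardMDP hη0 hη1 hτ0 hτ1 hc hd hdS θ) (fun _ _ => μ) (x j))
        (∏ j, pathWeight (G.hardMDP hη0 hη1 hτ0 hτ1 hc hd hdS (Function.update θ i (!θ i)))
          (fun _ _ => μ) (x j)) := by
  have hQ0 : ∀ (θ : Fin H × S → Bool) t (q q' : S × A), 0 ≤ G.hardChain η τ c μ θ t q q' :=
    fun θ t q q' => mul_nonneg (G.hardP_nonneg hη0 hη1 hτ0 hτ1 hc θ t _ _ _) (hμ0 _)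
  have h := le_two_mul_sum_min_prod_chainWeight (ν := fun q : S × A => d * μ q.2)
    (L := G.meanChain η τ c μ θ i) (n := n) (fun q => mul_nonneg hd (hμ0 _))
    (by
      simp only [Fintype.sum_prod_type, ← Finset.mul_sum, hμ1, mul_one, Finset.sum_const,
        Finset.card_univ, nsmul_eq_mul]
      linarith)
    (hQ0 θ) (G.sum_hardChain hμ1 θ) (hQ0 (Function.update θ i (!θ i)))
    (G.sum_hardChain hμ1 (Function.update θ i (!θ i)))
    (G.meanChain_sq_le hη0 hη1 hτ0 hτ1 hc θ i) hH hδ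
    (G.le_sum_forwardMass_meanChain hη0 hη1 hτ0 hτ1 hc hμ0 hμ1 hcμ hd hdS θ i (H - 1))
    (by linarith)
  have hsq : (7 / 8 : ℝ) ^ 2 ≤ (1 - n * (2 * d * η * τ ^ 2 * ∑ a, c a ^ 2 * μ a)) ^ 2 :=
    pow_le_pow_left₀ (by norm_num) (by linarith) 2
  have hquarter : ∀ y : ℝ, (7 / 8 : ℝ) ^ 2 ≤ 2 * y → 1 / 4 ≤ y := fun y hy => by linarith
  exact hquarter _ (hsq.trans h)

end

section

variable {S A : Type} [Fintype S] [DecidableEq S] [Inhabited S] [Fintype A] [DecidableEq A]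
  [Inhabited A] {η τ d x : ℝ} {H n : ℕ}

/-- Any estimator fails to be `ε`-accurate on all deterministic policies for one of the hard
instances, provided the episodes are few and the instances are well separated. -/
lemma Pairing.exists_hardMDP_failure [MeasurableSpace S] [MeasurableSingletonClass S]
    [MeasurableSpace A] [MeasurableSingletonClass A] (G : Pairing S) (hη0 : 0 ≤ η) (hη1 : η ≤ 1)
    (hηH : η * H ≤ 1 / 2) (hτ0 : 0 ≤ τ) (hτ1 : τ ≤ 1) {a₁ a₂ a₃ : A} (h₁₂ : a₁ ≠ a₂)
    (h₁₃ : a₁ ≠ a₃) (h₂₃ : a₂ ≠ a₃) (hx0 : 0 ≤ x) (hx : Fintype.card A * x ≤ 1) (hd : 0 ≤ d)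
    (hdS : Fintype.card S * d = 1) (hH : 0 < H) (hδ : 2 * d * η * τ ^ 2 * (2 * x) ≤ 1)
    (hn : n * (2 * d * η * τ ^ 2 * (2 * x)) ≤ 1 / 8) {ε : ℝ} (hε : 0 < ε)
    (hsep : 2 * ε ≤ η * τ * d / 2 * (1 / 16 * (H * (H - 1) / 2 * ∑ s, G.sign s ^ 2)))
    (vest : Dataset S A H n → (ℕ → S → A) → ℝ) :
    ∃ θ : Fin H × S → Bool, ENNReal.ofReal (1 / 16) ≤
      datasetLaw (G.hardMDP hη0 hη1 hτ0 hτ1 (abs_actionScore_le_one a₁ a₂) hd hdS θ)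
        (fun _ _ => logPolicy x a₃) (fun _ s _ => Measure.dirac ((1 + G.sign s) / 2)) H n
        {D | ∃ g : ℕ → S → A, ε ≤ |vest D g -
          polValue (G.hardP η τ (actionScore a₁ a₂) θ) (fun _ s _ => (1 + G.sign s) / 2)
            (fun _ => d) (detToPolicy g) H|} := by
  classical
  have hμ := isPolicy_logPolicy S hx0 hx a₃
  set v : (Fin H × S → Bool) → (ℕ → S → A) → ℝ := fun θ g =>
    polValue (G.hardP η τ (actionScore a₁ a₂) θ) (fun _ s _ => (1 + G.sign s) / 2) (fun _ => d)
      (detToPolicy g) H with hv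
  let data : (Fin n → Fin H → S × A) → Dataset S A H n := fun y i =>
    episodeOfPath (fun _ s _ => (1 + G.sign s) / 2) (y i)
  have hηhalf : 0 < η * τ * d / 2 := by
    have h0 : 0 ≤ η * τ * d / 2 := by positivity
    refine h0.lt_of_ne fun h => ?_
    rw [← h, zero_mul] at hsep
    linarith
  have hC : 0 < ∑ i, G.bitWeight H i := by
    rw [G.sum_bitWeight]
    by_contra! h
    nlinarith
  obtain ⟨θ, hθ⟩ := exists_failure_ge (G.bitWeight H) G.bitWeight_nonneg
    (fun θ (y : Fin n → Fin H → S × A) => ∏ j, pathWeight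
      (G.hardMDP hη0 hη1 hτ0 hτ1 (abs_actionScore_le_one a₁ a₂) hd hdS θ)
      (fun _ _ => logPolicy x a₃) (y j))
    (fun θ y => prod_pathWeight_nonneg _ hμ y) (fun θ => sum_prod_pathWeight_eq_one _ hμ hH)
    (β := 1 / 4) (B := 1 / 4 / 4 * ∑ i, G.bitWeight H i)
    (G.quarter_le_sum_min_prod_pathWeight hη0 hη1 hτ0 hτ1 (abs_actionScore_le_one a₁ a₂) hd hdS
      (fun a => hx0.trans (le_logPolicy hx a₃ a)) (sum_logPolicy x a₃)
      (sum_actionScore_mul_logPolicy x h₁₃ h₂₃) hH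
      (by rwa [sum_actionScore_sq_mul_logPolicy x h₁₂ h₁₃ h₂₃])
      (by rwa [sum_actionScore_sq_mul_logPolicy x h₁₂ h₁₃ h₂₃]))
    (fun θ y => ∀ σ : Fin H × S → Bool,
      |vest (data y) (G.signPolicy a₁ a₂ σ) - v θ (G.signPolicy a₁ a₂ σ)| < ε)
    (by
      intro y θ θ' h h'
      have hval := G.le_polValue_sub (c := actionScore a₁ a₂) θ θ' hη0 hτ0 hd
        (G.signPolicy_partner a₁ a₂ θ) (fun t ht => G.actionScore_signPolicy h₁₂ θ ht) hηH
      have h1 := abs_lt.1 (h θ)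
      have h2 := abs_lt.1 (h' θ)
      simp only [hv] at h1 h2
      rw [G.sum_bitWeight]
      refine le_of_mul_le_mul_left (hval.trans ?_) hηhalf
      linarith [h1.1, h1.2, h2.1, h2.2])
    hC le_rfl
  have h16 : (1 / 16 : ℝ) = 1 / 4 / 4 := by norm_num
  rw [← h16] at hθ
  refine ⟨θ, (ENNReal.ofReal_le_ofReal hθ).trans
    (sum_prod_pathWeight_le_datasetLaw _ hμ _ _ _ fun y hy => ?_)⟩
  obtain ⟨σ, hσ⟩ := not_forall.1 (Finset.mem_filter.1 hy).2
  exact ⟨_, not_lt.1 hσ⟩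

end

/-- Theorem 3.4, minimax lower bound for uniform OPE: over the class
`M_{d_m}` of pairs `(μ, M)` with `min_{t,s,a} d_t^μ(s,a) ≥ d_m`, any OPE procedure that is
uniformly `ε`-accurate over all deterministic policies with constant probability needs
`n = Ω(H³/(d_m ε²))` episodes. -/
theorem uniform_ope_lower_bound :
    ∃ c₁ c₂ c₃ p : ℝ, 0 < c₁ ∧ 0 < c₂ ∧ 0 < c₃ ∧ 0 < p ∧
      ∀ (S A : Type) [Fintype S] [Fintype A] [DecidableEq S] [DecidableEq A]
        [Inhabited S] [Inhabited A]
        [MeasurableSpace S] [MeasurableSingletonClass S]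
        [MeasurableSpace A] [MeasurableSingletonClass A]
        (H n : ℕ) (dm ε : ℝ),
        c₁ ≤ (H : ℝ) → c₁ ≤ (Fintype.card S : ℝ) → c₁ ≤ (Fintype.card A : ℝ) →
        0 < dm → dm ≤ 1 / ((Fintype.card S : ℝ) * (Fintype.card A : ℝ)) →
        0 < ε → ε < c₂ →
        (n : ℝ) ≤ c₃ * (H : ℝ) ^ 3 / (dm * ε ^ 2) →
        ∀ vest : Dataset S A H n → (ℕ → S → A) → ℝ, Measurable vest →
          ∃ (M : MDP S A) (μ : ℕ → S → A → ℝ) (R : ℕ → S → A → Measure ℝ),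
            IsPolicy μ ∧ ValidReward M R ∧
            (∀ t < H, ∀ q : S × A, dm ≤ margDist M.P M.d₁ μ t q) ∧
            ENNReal.ofReal p ≤
              datasetLaw M μ R H n
                {D | ∃ g : ℕ → S → A,
                  ε ≤ |vest D g - polValue M.P M.r M.d₁ (detToPolicy g) H|} := by
  refine ⟨3, 1 / 576, 1 / (16 * 576 ^ 2), 1 / 16, by norm_num, by norm_num, by norm_num,
    by norm_num, ?_⟩
  intro S A _ _ _ _ _ _ _ _ _ _ H n dm ε hH hS hA hdm0 hdm hε0 hε hn vest _
  obtain ⟨a₁, a₂, a₃, h₁₂, h₁₃, h₂₃⟩ := Fintype.two_lt_card_iff.1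
    (by exact_mod_cast (show (2 : ℝ) < Fintype.card A by linarith))
  set N : ℝ := (Fintype.card S : ℝ)
  have hN0 : 0 < N := by linarith
  have hA0 : (0 : ℝ) < Fintype.card A := by linarith
  have hH0 : (0 : ℝ) < H := by linarith
  have hdmNA : dm * (N * Fintype.card A) ≤ 1 := (le_div_iff₀ (by positivity)).1 hdm
  have hx0 : 0 ≤ N * dm := by positivity
  have hx : Fintype.card A * (N * dm) ≤ 1 := by linarith
  have hdS : N * (1 / N) = 1 := by field_simp
  have hη0 : 0 ≤ 1 / (2 * (H : ℝ)) := by positivity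
  have hη1 : 1 / (2 * (H : ℝ)) ≤ 1 := by
    rw [div_le_one (by positivity)]
    linarith
  have hηH : 1 / (2 * (H : ℝ)) * H ≤ 1 / 2 := le_of_eq (by field_simp)
  have hτ0 : 0 ≤ 576 * ε / H := by positivity
  have hτ1 : 576 * ε / H ≤ 1 := by
    rw [div_le_one hH0]
    linarith
  have hloss : 2 * (1 / N) * (1 / (2 * (H : ℝ))) * (576 * ε / H) ^ 2 * (2 * (N * dm)) =
      2 * 576 ^ 2 * (dm * ε ^ 2) / H ^ 3 := by
    field_simp
  have hdm1 : dm ≤ 1 := by nlinarith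
  have hδ : 2 * (1 / N) * (1 / (2 * (H : ℝ))) * (576 * ε / H) ^ 2 * (2 * (N * dm)) ≤ 1 := by
    rw [hloss, div_le_one (by positivity)]
    have hε2 : 576 ^ 2 * ε ^ 2 ≤ 1 := by nlinarith
    have hH3 : (3 : ℝ) ^ 3 ≤ H ^ 3 := pow_le_pow_left₀ (by norm_num) hH 3
    nlinarith
  have hnδ : n * (2 * (1 / N) * (1 / (2 * (H : ℝ))) * (576 * ε / H) ^ 2 * (2 * (N * dm))) ≤
      1 / 8 := by
    rw [hloss, ← mul_div_assoc, div_le_iff₀ (by positivity)]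
    rw [le_div_iff₀ (by positivity)] at hn
    linarith
  set G := (finPairing (Fintype.card S)).map (Fintype.equivFin S).symm
  have hsep : 2 * ε ≤ 1 / (2 * (H : ℝ)) * (576 * ε / H) * (1 / N) / 2 *
      (1 / 16 * (H * (H - 1) / 2 * ∑ s, G.sign s ^ 2)) := by
    have hsign := G.card_sub_one_le
    have hcount : 2 * N * H / 9 ≤ (H - 1) / 2 * ∑ s, G.sign s ^ 2 := by nlinarith
    have heq : 1 / (2 * (H : ℝ)) * (576 * ε / H) * (1 / N) / 2 *
        (1 / 16 * (H * (H - 1) / 2 * ∑ s, G.sign s ^ 2)) =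
        9 * ε / (N * H) * ((H - 1) / 2 * ∑ s, G.sign s ^ 2) := by
      field_simp
      ring
    rw [heq, div_mul_eq_mul_div, le_div_iff₀ (by positivity)]
    nlinarith
  obtain ⟨θ, hθ⟩ := G.exists_hardMDP_failure hη0 hη1 hηH hτ0 hτ1 h₁₂ h₁₃ h₂₃ hx0 hx
    (by positivity) hdS (by exact_mod_cast hH0) hδ hnδ hε0 hsep vest
  refine ⟨_, _, _, isPolicy_logPolicy S hx0 hx a₃, validReward_dirac _, fun t _ q => ?_, hθ⟩
  have hmarg := G.margDist_hardP (η := 1 / (2 * (H : ℝ))) (τ := 576 * ε / H) θ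
    (sum_logPolicy (N * dm) a₃) (sum_actionScore_mul_logPolicy (N * dm) h₁₃ h₂₃) (1 / N) t q
  refine le_trans ?_ hmarg.ge
  calc dm = 1 / N * (N * dm) := by field_simp
    _ ≤ 1 / N * logPolicy (N * dm) a₃ q.2 :=
      mul_le_mul_of_nonneg_left (le_logPolicy hx a₃ q.2) (by positivity)

end OPE
end
end

section
/- For any finite, time-inhomogeneous episodic MDP with mean rewards r_t(s,a) in [0,1] and any non-stationary policy pi, for every time t in [H] and every state-action pair (s,a): sum_{h=t+1}^H ( Gamma_{t+1:h-1}^pi sigma_h^pi )(s,a) <= sqrt( (H - t)^3 ), where Gamma_{t+1:h-1}^pi = prod_{i=t+1}^{h-1} P_i^pi is the multi-step state-action transition matrix (equal to the identity when h - 1 < t + 1), P_i^pi((s',a') | (s,a)) = P_i(s'|s,a) pi_i(a'|s'), and sigma_h^pi(s,a) := sqrt( Var_{s' ~ P_h(.|s,a)} [ V_h^pi(s') ] ). -/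
open MeasureTheory Finset

noncomputable section

namespace OPE

variable {S A : Type} [Fintype S] [Fintype A] [DecidableEq S] [DecidableEq A]
  [Inhabited S] [Inhabited A]

/-- The state-action transition matrix `P_t^π` of policy `π`, transitioning from time `t` to
time `t+1`: `P^π((s',a')|(s,a)) = P_t(s'|s,a) π_{t+1}(a'|s')`. -/
def stepMat (M : MDP S A) (π : ℕ → S → A → ℝ) (t : ℕ) (q q' : S × A) : ℝ :=
  M.P t q.1 q.2 q'.1 * π (t + 1) q'.1 q'.2

/-- `multiStep M π t k f` is the multi-step state-action transition operator
`Γ^π = P_t^π ⋯ P_{t+k-1}^π` applied to the vector `f` (so `k = 0` gives the identity). -/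
def multiStep (M : MDP S A) (π : ℕ → S → A → ℝ) : ℕ → ℕ → (S × A → ℝ) → S × A → ℝ
  | _, 0, f => f
  | t, k + 1, f => fun q => ∑ q' : S × A, stepMat M π t q q' * multiStep M π (t + 1) k f q'

/-- `σ_τ^π(s,a) = √(Var_{s' ~ P_τ(·|s,a)}[V_{τ+1}^π(s')])`, the conditional standard deviation
of the next-step value. -/
def sigmaV (M : MDP S A) (π : ℕ → S → A → ℝ) (H τ : ℕ) (q : S × A) : ℝ :=
  Real.sqrt (∑ s', M.P τ q.1 q.2 s' *
    (Vf M.P M.r π H (τ + 1) s' -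
      ∑ s'', M.P τ q.1 q.2 s'' * Vf M.P M.r π H (τ + 1) s'') ^ 2)

section TotalVariance

variable {X U : Type} [Fintype X] [Fintype U]

lemma stepMat_nonneg (M : MDP X U) {π : ℕ → X → U → ℝ} (hπ : IsPolicy π) (t : ℕ)
    (q q' : X × U) : 0 ≤ stepMat M π t q q' :=
  mul_nonneg (M.P_nonneg _ _ _ _) (hπ.1 _ _ _)

lemma sum_stepMat_mul (M : MDP X U) (π : ℕ → X → U → ℝ) (t : ℕ) (q : X × U) (f : X × U → ℝ) :
    ∑ q', stepMat M π t q q' * f q' =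
      ∑ s', M.P t q.1 q.2 s' * ∑ a', π (t + 1) s' a' * f (s', a') := by
  rw [Fintype.sum_prod_type]
  simp only [stepMat, Finset.mul_sum, mul_assoc]

lemma sum_stepMat (M : MDP X U) {π : ℕ → X → U → ℝ} (hπ : IsPolicy π) (t : ℕ) (q : X × U) :
    ∑ q', stepMat M π t q q' = 1 := by
  simpa [hπ.2, M.P_sum] using sum_stepMat_mul M π t q fun _ => 1

/-- A pointwise affine bound is preserved by the multi-step transition operator. -/
lemma multiStep_le_affine (M : MDP X U) {π : ℕ → X → U → ℝ} (hπ : IsPolicy π)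
    {f g : X × U → ℝ} {a b : ℝ} (h : ∀ q, f q ≤ a * g q + b) (k t : ℕ) (q : X × U) :
    multiStep M π t k f q ≤ a * multiStep M π t k g q + b := by
  induction k generalizing t q with
  | zero => exact h q
  | succ k ih =>
    calc ∑ q', stepMat M π t q q' * multiStep M π (t + 1) k f q'
        ≤ ∑ q', stepMat M π t q q' * (a * multiStep M π (t + 1) k g q' + b) :=
          Finset.sum_le_sum fun q' _ =>
            mul_le_mul_of_nonneg_left (ih (t + 1) q') (stepMat_nonneg M hπ t q q')
      _ = a * ∑ q', stepMat M π t q q' * multiStep M π (t + 1) k g q' +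
            (∑ q', stepMat M π t q q') * b := by
          rw [Finset.mul_sum, Finset.sum_mul, ← Finset.sum_add_distrib]
          exact Finset.sum_congr rfl fun _ _ => by ring
      _ = _ := by rw [sum_stepMat M hπ, one_mul]; rfl

lemma Vaux_mem_Icc (M : MDP X U) {π : ℕ → X → U → ℝ} (hπ : IsPolicy π) (k t : ℕ) (s : X) :
    Vaux M.P M.r π k t s ∈ Set.Icc (0 : ℝ) k := by
  induction k generalizing t s with
  | zero => simp [Vaux]
  | succ k ih =>
    have hnext (a : U) :
        ∑ s', M.P t s a s' * Vaux M.P M.r π k (t + 1) s' ∈ Set.Icc (0 : ℝ) k :=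
      (convex_Icc (0 : ℝ) k).sum_mem (fun _ _ => M.P_nonneg _ _ _ _) (M.P_sum _ _ _)
        fun s' _ => ih (t + 1) s'
    refine (convex_Icc (0 : ℝ) (k + 1 : ℕ)).sum_mem (fun _ _ => hπ.1 _ _ _) (hπ.2 _ _)
      fun a _ => ⟨?_, ?_⟩
    · exact add_nonneg (M.r_nonneg _ _ _) (hnext a).1
    · push_cast
      linarith [M.r_le_one t s a, (hnext a).2]

lemma sum_mul_sub_mean_sq {ι : Type*} [Fintype ι] {p f : ι → ℝ} (hp : ∑ i, p i = 1) :
    ∑ i, p i * (f i - ∑ j, p j * f j) ^ 2 = ∑ i, p i * f i ^ 2 - (∑ i, p i * f i) ^ 2 := by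
  set m := ∑ j, p j * f j with hm
  have h (i : ι) : p i * (f i - m) ^ 2 = p i * f i ^ 2 - 2 * m * (p i * f i) + m ^ 2 * p i := by
    ring
  simp only [h, Finset.sum_add_distrib, Finset.sum_sub_distrib, ← Finset.mul_sum, hp, ← hm]
  ring

lemma sigmaV_sq (M : MDP X U) (π : ℕ → X → U → ℝ) (H t : ℕ) (q : X × U) :
    sigmaV M π H t q ^ 2 = ∑ s', M.P t q.1 q.2 s' * Vf M.P M.r π H (t + 1) s' ^ 2 -
      (∑ s', M.P t q.1 q.2 s' * Vf M.P M.r π H (t + 1) s') ^ 2 := by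
  rw [sigmaV, Real.sq_sqrt, sum_mul_sub_mean_sq (M.P_sum _ _ _)]
  exact Finset.sum_nonneg fun _ _ => mul_nonneg (M.P_nonneg _ _ _ _) (sq_nonneg _)

/-- Law of total variance: the accumulated conditional variances together with the squared mean
return are bounded by the square of the maximal return. -/
lemma sum_multiStep_sigmaV_sq_add_le (M : MDP X U) {π : ℕ → X → U → ℝ} (hπ : IsPolicy π)
    (n t : ℕ) (q : X × U) :
    ∑ j ∈ Finset.range n, multiStep M π t j (fun p => sigmaV M π (t + 1 + n) (t + j) p ^ 2) q +
      (∑ s', M.P t q.1 q.2 s' * Vaux M.P M.r π n (t + 1) s') ^ 2 ≤ (n : ℝ) ^ 2 := by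
  induction n generalizing t q with
  | zero => simp [Vaux]
  | succ n ih =>
    set W : X × U → ℝ := fun q' => ∑ j ∈ Finset.range n,
      multiStep M π (t + 1) j (fun p => sigmaV M π (t + 1 + 1 + n) (t + 1 + j) p ^ 2) q' with hW
    have hsum : ∑ j ∈ Finset.range (n + 1),
        multiStep M π t j (fun p => sigmaV M π (t + 1 + (n + 1)) (t + j) p ^ 2) q =
        ∑ q', stepMat M π t q q' * W q' + sigmaV M π (t + 1 + (n + 1)) t q ^ 2 := by
      rw [Finset.sum_range_succ']
      congr 1
      simp only [hW, Finset.mul_sum]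
      rw [Finset.sum_comm]
      refine Finset.sum_congr rfl fun j _ => ?_
      rw [show t + 1 + (n + 1) = t + 1 + 1 + n by omega, show t + (j + 1) = t + 1 + j by omega]
      rfl
    have hV (s' : X) :
        Vf M.P M.r π (t + 1 + (n + 1)) (t + 1) s' = Vaux M.P M.r π (n + 1) (t + 1) s' := by
      rw [Vf, Nat.add_sub_cancel_left]
    have hstate (s' : X) : ∑ a', π (t + 1) s' a' * W (s', a') +
        Vaux M.P M.r π (n + 1) (t + 1) s' ^ 2 ≤ ((n + 1 : ℕ) : ℝ) ^ 2 := by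
      have jensen : Vaux M.P M.r π (n + 1) (t + 1) s' ^ 2 ≤ ∑ a', π (t + 1) s' a' *
          (M.r (t + 1) s' a' +
            ∑ s'', M.P (t + 1) s' a' s'' * Vaux M.P M.r π n (t + 1 + 1) s'') ^ 2 :=
        (even_two.convexOn_pow (𝕜 := ℝ)).map_sum_le (fun _ _ => hπ.1 _ _ _) (hπ.2 _ _)
          fun _ _ => Set.mem_univ _
      refine (add_le_add_right jensen _).trans ?_
      rw [← Finset.sum_add_distrib]
      calc _ ≤ ∑ a', π (t + 1) s' a' * ((n + 1 : ℕ) : ℝ) ^ 2 := by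
            refine Finset.sum_le_sum fun a' _ => ?_
            rw [← mul_add]
            refine mul_le_mul_of_nonneg_left ?_ (hπ.1 _ _ _)
            have hi := ih (t + 1) (s', a')
            have hm : ∑ s'', M.P (t + 1) s' a' s'' * Vaux M.P M.r π n (t + 1 + 1) s'' ∈
                Set.Icc (0 : ℝ) n :=
              (convex_Icc (0 : ℝ) n).sum_mem (fun _ _ => M.P_nonneg _ _ _ _) (M.P_sum _ _ _)
                fun s'' _ => Vaux_mem_Icc M hπ n (t + 1 + 1) s''
            have h0 := M.r_nonneg (t + 1) s' a'
            have h1 := M.r_le_one (t + 1) s' a'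
            have hprod := mul_le_mul h1 hm.2 hm.1 zero_le_one
            have hsq := pow_le_one₀ (n := 2) h0 h1
            push_cast
            dsimp only [W] at hi ⊢
            linarith
        _ = _ := by rw [← Finset.sum_mul, hπ.2, one_mul]
    rw [hsum, sigmaV_sq, sum_stepMat_mul]
    simp only [hV]
    calc _ = ∑ s', M.P t q.1 q.2 s' * (∑ a', π (t + 1) s' a' * W (s', a') +
            Vaux M.P M.r π (n + 1) (t + 1) s' ^ 2) := by
          simp only [mul_add, Finset.sum_add_distrib]
          ring
      _ ≤ ∑ s', M.P t q.1 q.2 s' * ((n + 1 : ℕ) : ℝ) ^ 2 :=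
          Finset.sum_le_sum fun s' _ =>
            mul_le_mul_of_nonneg_left (hstate s') (M.P_nonneg _ _ _ _)
      _ = _ := by rw [← Finset.sum_mul, M.P_sum, one_mul]

end TotalVariance

/-- Lemma E.6, law-of-total-variance bound: for every time `τ` (0-based) and
every state-action pair `(s,a)`,
`∑_{h=t+1}^H (Γ_{t+1:h-1}^π √(Var(V_h^π)))(s,a) ≤ √((H-t)³)`. -/
theorem sum_multistep_stddev_le
    (M : MDP S A) (π : ℕ → S → A → ℝ) (hπ : IsPolicy π) (H : ℕ)
    (τ : ℕ) (hτ : τ < H) (q : S × A) :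
    ∑ j ∈ Finset.range (H - 1 - τ), multiStep M π τ j (sigmaV M π H (τ + j)) q ≤
      Real.sqrt (((H - 1 - τ : ℕ) : ℝ) ^ 3) := by
  obtain ⟨n, rfl⟩ : ∃ n, H = τ + 1 + n := ⟨H - (τ + 1), by omega⟩
  rw [show τ + 1 + n - 1 - τ = n by omega]
  rcases Nat.eq_zero_or_pos n with rfl | hn
  · simp
  set c := Real.sqrt n with hc
  have hcpos : 0 < c := Real.sqrt_pos.2 (by exact_mod_cast hn)
  have hcsq : c ^ 2 = n := Real.sq_sqrt n.cast_nonneg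
  have amgm (x : ℝ) : x ≤ 1 / (2 * c) * x ^ 2 + c / 2 := by
    have : 1 / (2 * c) * x ^ 2 + c / 2 - x = (x - c) ^ 2 / (2 * c) := by
      field_simp
      ring
    have : 0 ≤ (x - c) ^ 2 / (2 * c) := by positivity
    linarith
  have hvar := (le_add_of_nonneg_right (sq_nonneg _)).trans
    (sum_multiStep_sigmaV_sq_add_le M hπ n τ q)
  rw [← hcsq, ← pow_mul, show c ^ (2 * 3) = (c ^ 3) ^ 2 by ring, Real.sqrt_sq (by positivity)]
  calc _ ≤ ∑ j ∈ Finset.range n, (1 / (2 * c) *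
          multiStep M π τ j (fun p => sigmaV M π (τ + 1 + n) (τ + j) p ^ 2) q + c / 2) :=
        Finset.sum_le_sum fun j _ => multiStep_le_affine M hπ (fun _ => amgm _) j τ q
    _ = 1 / (2 * c) * ∑ j ∈ Finset.range n,
          multiStep M π τ j (fun p => sigmaV M π (τ + 1 + n) (τ + j) p ^ 2) q + n * (c / 2) := by
        rw [Finset.sum_add_distrib, ← Finset.mul_sum]
        simp
    _ ≤ 1 / (2 * c) * (n : ℝ) ^ 2 + n * (c / 2) := by gcongr
    _ = c ^ 3 := by
        rw [← hcsq]
        field_simp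
        ring

end OPE
end
end
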